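/- arXiv:0903.4517 — 2 statements merged into one kernel-verified Lean document; each statement's English description precedes it below -/
import Mathlib

section
/- For the alternating group A_4 on four letters and every integer k ≥ 0, the group homology with trivial ℤ/2-coefficients satisfies, as abelian groups: H_{6k+1}(A_4; ℤ/2) ≅ (ℤ/2)^{2k}; H_{6k+2}(A_4; ℤ/2) ≅ (ℤ/2)^{2k+1}; H_{6k+3}(A_4; ℤ/2) ≅ (ℤ/2)^{2k+2}; H_{6k+4}(A_4; ℤ/2) ≅ (ℤ/2)^{2k+1}; H_{6k+5}(A_4; ℤ/2) ≅ (ℤ/2)^{2k+2}; and H_{6k+6}(A_4; ℤ/2) ≅ (ℤ/2)^{2k+3}. -/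
/-!
Group homology via the inhomogeneous bar complex (trivial coefficients).
-/

namespace BarHomology

/-- The `n`-th term of the inhomogeneous bar complex of `G` with trivial coefficients in `A`. -/
abbrev chains (G : Type) (A : Type) [AddCommGroup A] (n : ℕ) : Type := (Fin n → G) →₀ A

/-- The differential of the inhomogeneous bar complex with trivial coefficients:
`d (g₁, …, g_{n+1}) = (g₂, …, g_{n+1}) + ∑_{j=1}^{n} (-1)^j (g₁, …, g_j g_{j+1}, …, g_{n+1})
  + (-1)^{n+1} (g₁, …, g_n)`. -/
noncomputable def d (k : Type) [CommRing k] (G : Type) [Group G] (A : Type) [AddCommGroup A]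
    [Module k A] (n : ℕ) : chains G A (n + 1) →ₗ[k] chains G A n :=
  Finsupp.lsum k fun g =>
    (Finsupp.lsingle (fun i => g i.succ) : A →ₗ[k] chains G A n)
      + ∑ j : Fin (n + 1),
          ((-1 : k) ^ ((j : ℕ) + 1)) • (Finsupp.lsingle (Fin.contractNth j (· * ·) g))

/-- The cycles: everything in degree `0`, the kernel of the differential in positive degrees. -/
noncomputable def cycles (k : Type) [CommRing k] (G : Type) [Group G] (A : Type) [AddCommGroup A]
    [Module k A] : (n : ℕ) → Submodule k (chains G A n)
  | 0 => ⊤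
  | (n + 1) => LinearMap.ker (d k G A n)

/-- The boundaries, viewed as a submodule of the cycles. -/
noncomputable def boundariesIn (k : Type) [CommRing k] (G : Type) [Group G] (A : Type)
    [AddCommGroup A] [Module k A] (n : ℕ) : Submodule k (cycles k G A n) :=
  (LinearMap.range (d k G A n)).comap (cycles k G A n).subtype

/-- Group homology of `G` in degree `n` with trivial coefficients in the `k`-module `A`,
defined as cycles modulo boundaries in the inhomogeneous bar complex. -/
abbrev GroupHomology (k : Type) [CommRing k] (G : Type) [Group G] (A : Type) [AddCommGroup A]
    [Module k A] (n : ℕ) : Type :=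
  ↥(cycles k G A n) ⧸ boundariesIn k G A n

section Maps

variable {k : Type} [CommRing k] {G G' : Type} [Group G] [Group G'] {A : Type} [AddCommGroup A]
  [Module k A]

/-- The chain map induced by a group homomorphism. -/
noncomputable def chainsMap (k : Type) [CommRing k] (A : Type) [AddCommGroup A] [Module k A]
    (φ : G →* G') (n : ℕ) : chains G A n →ₗ[k] chains G' A n :=
  Finsupp.lmapDomain A k (fun f => φ ∘ f)

lemma comp_contractNth (φ : G →* G') {n : ℕ} (j : Fin (n + 1)) (g : Fin (n + 1) → G) :
    φ ∘ Fin.contractNth j (· * ·) g = Fin.contractNth j (· * ·) (φ ∘ g) := by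
  funext i
  rcases lt_trichotomy (i : ℕ) (j : ℕ) with h | h | h
  · simp [Function.comp_apply, Fin.contractNth_apply_of_lt _ _ _ _ h]
  · simp [Function.comp_apply, Fin.contractNth_apply_of_eq _ _ _ _ h, map_mul]
  · simp [Function.comp_apply, Fin.contractNth_apply_of_gt _ _ _ _ h]

lemma chainsMap_comm (φ : G →* G') (n : ℕ) :
    (d k G' A n).comp (chainsMap k A φ (n + 1))
      = (chainsMap k A φ n).comp (d k G A n) := by
  apply Finsupp.lhom_ext
  intro g a
  simp only [LinearMap.comp_apply, chainsMap, Finsupp.lmapDomain_apply, Finsupp.mapDomain_single,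
    d, Finsupp.lsum_single, LinearMap.add_apply, LinearMap.sum_apply, LinearMap.smul_apply,
    Finsupp.lsingle_apply, map_add, map_sum, map_smul]
  congr 1
  refine Finset.sum_congr rfl fun j _ => ?_
  rw [comp_contractNth]

lemma chainsMap_mem_cycles (φ : G →* G') {n : ℕ} {x : chains G A n}
    (hx : x ∈ cycles k G A n) : chainsMap k A φ n x ∈ cycles k G' A n := by
  cases n with
  | zero => trivial
  | succ n =>
    simp only [cycles, LinearMap.mem_ker] at hx ⊢
    have := LinearMap.congr_fun (chainsMap_comm (k := k) (A := A) φ n) x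
    simp only [LinearMap.comp_apply] at this
    rw [this, hx, map_zero]

/-- The map induced by a group homomorphism on cycles. -/
noncomputable def cyclesMap (k : Type) [CommRing k] (A : Type) [AddCommGroup A] [Module k A]
    (φ : G →* G') (n : ℕ) : ↥(cycles k G A n) →ₗ[k] ↥(cycles k G' A n) :=
  (chainsMap k A φ n).restrict fun _ hx => chainsMap_mem_cycles φ hx

/-- The map induced by a group homomorphism on group homology with trivial coefficients. -/
noncomputable def inducedMap (k : Type) [CommRing k] (A : Type) [AddCommGroup A] [Module k A]
    (φ : G →* G') (n : ℕ) :
    GroupHomology k G A n →ₗ[k] GroupHomology k G' A n :=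
  Submodule.mapQ (boundariesIn k G A n) (boundariesIn k G' A n) (cyclesMap k A φ n) (by
    rintro ⟨x, hx⟩ hb
    simp only [boundariesIn, Submodule.mem_comap, Submodule.subtype_apply,
      LinearMap.mem_range] at hb ⊢
    obtain ⟨w, hw⟩ := hb
    refine ⟨chainsMap k A φ (n + 1) w, ?_⟩
    have := LinearMap.congr_fun (chainsMap_comm (k := k) (A := A) φ n) w
    simp only [LinearMap.comp_apply] at this
    rw [this, hw]
    rfl)

end Maps

end BarHomology

open BarHomology

namespace AlternatingFour

open CategoryTheory

/-- The field with four elements, as `𝔽₂[ω]` with `ω² = 1 + ω`. -/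
abbrev F4 : Type := QuadraticAlgebra (ZMod 2) 1 1

/-- The group `A₄`. -/
abbrev A4 : Type := ↥(alternatingGroup (Fin 4))

instance : Finite F4 := Finite.of_equiv _ (QuadraticAlgebra.equivProd (1 : ZMod 2) 1).symm

lemma card_F4 : Nat.card F4 = 4 := by
  rw [Nat.card_congr (QuadraticAlgebra.equivProd (1 : ZMod 2) 1)]
  simp

instance : CharP F4 2 :=
  CharTwo.of_one_ne_zero_of_two_eq_zero (by decide) (by decide)

/-- The identification of the four letters with the affine line over `F4`, under which `A₄`
becomes the group of affine bijections. -/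
def point : Fin 4 → F4 := ![0, 1, ⟨0, 1⟩, ⟨1, 1⟩]

/-- The linear part of a permutation acting affinely on `F4`. -/
def slope (g : Equiv.Perm (Fin 4)) : F4 := point (g 1) - point (g 0)

lemma point_apply_sub (g : A4) (i j : Fin 4) :
    point (g.1 i) - point (g.1 j) = slope g.1 * (point i - point j) := by
  have key : ∀ g : Equiv.Perm (Fin 4), Equiv.Perm.sign g = 1 →
      ∀ i j, point (g i) - point (g j) = slope g * (point i - point j) := by decide +kernel
  exact key g.1 (Equiv.Perm.mem_alternatingGroup.1 g.2) i j

/-- The linear part, as a character of `A₄` with values in `F4`. -/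
def character : A4 →* F4 where
  toFun g := slope g.1
  map_one' := by decide
  map_mul' g h := by
    change point (g.1 (h.1 1)) - point (g.1 (h.1 0)) = _
    rw [point_apply_sub]
    rfl

lemma point_sub_apply (g : A4) (i j : Fin 4) :
    point i - point (g.1 j) = character g * (point (g.1⁻¹ i) - point j) := by
  have := point_apply_sub g (g.1⁻¹ i) j
  rwa [show g.1 (g.1⁻¹ i) = i by simp] at this

lemma character_pow_three (g : A4) : character g ^ 3 = 1 := by
  have key : ∀ g : Equiv.Perm (Fin 4), Equiv.Perm.sign g = 1 → slope g ^ 3 = 1 := by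
    decide +kernel
  exact key g.1 (Equiv.Perm.mem_alternatingGroup.1 g.2)

lemma exists_translation (i : Fin 4) : ∃ g : A4, g.1 0 = i ∧ character g = 1 := by
  have key : ∀ i : Fin 4, ∃ g : Equiv.Perm (Fin 4),
      Equiv.Perm.sign g = 1 ∧ g 0 = i ∧ slope g = 1 := by decide +kernel
  obtain ⟨g, hg, h⟩ := key i
  exact ⟨⟨g, Equiv.Perm.mem_alternatingGroup.2 hg⟩, h⟩

lemma exists_homothety : ∃ g : A4, g.1 0 = 0 ∧ character g = ⟨0, 1⟩ := by
  have key : ∃ g : Equiv.Perm (Fin 4),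
      Equiv.Perm.sign g = 1 ∧ g 0 = 0 ∧ slope g = ⟨0, 1⟩ := by decide +kernel
  obtain ⟨g, hg, h⟩ := key
  exact ⟨⟨g, Equiv.Perm.mem_alternatingGroup.2 hg⟩, h⟩

lemma card_stabilizer (i : Fin 4) :
    (∑ g : A4, if g.1⁻¹ i = 0 then (1 : F4) else 0) = 1 := by
  revert i
  decide +kernel

/-- Functions on the four letters. -/
abbrev Functions : Type := Fin 4 → F4

/-- Convolution with `t ↦ t` on functions on `F4`; on polynomials it is the second divided
derivative. -/
def convU : Matrix (Fin 4) (Fin 4) F4 := .of fun i j => point i - point j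

/-- Convolution with `t ↦ t²` on functions on `F4`; on polynomials it is the derivative. -/
def convV : Matrix (Fin 4) (Fin 4) F4 := .of fun i j => (point i - point j) ^ 2

/-- The operator `1 ↦ x²`, `x ↦ x³`, `x² ↦ 0`, `x³ ↦ 0`, a contraction of `convU`. -/
def homotopyU : Matrix (Fin 4) (Fin 4) F4 :=
  .of fun i j => point i ^ 2 * (if j = 0 then 1 else 0) + point i ^ 3 * point j ^ 2

/-- The operator `1 ↦ x`, `x² ↦ x³`, `x ↦ 0`, `x³ ↦ 0`, a contraction of `convV`. -/
def homotopyV : Matrix (Fin 4) (Fin 4) F4 :=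
  .of fun i j => point i * (if j = 0 then 1 else 0) + point i ^ 3 * point j

lemma convU_mul_self : convU * convU = 0 := by decide +kernel

lemma convV_mul_self : convV * convV = 0 := by decide +kernel

lemma convU_mul_convV : convU * convV = convV * convU := by decide +kernel

lemma convV_mul_homotopyU : convV * homotopyU = homotopyU * convV := by decide +kernel

lemma convU_mul_homotopyU : convU * homotopyU = 1 + homotopyU * convU := by decide +kernel

lemma convV_mul_homotopyV : convV * homotopyV = 1 + homotopyV * convV := by decide +kernel

lemma convV_mul_convU : convV * convU = .of fun _ _ => 1 := by decide +kernel

lemma sum_convU (f : Functions) : ∑ i, (convU.mulVec f) i = 0 := by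
  have h : ∀ j, ∑ i, convU i j = 0 := by decide +kernel
  simp only [Matrix.mulVec, dotProduct]
  rw [Finset.sum_comm]
  simp [← Finset.sum_mul, h]

lemma sum_convV (f : Functions) : ∑ i, (convV.mulVec f) i = 0 := by
  have h : ∀ j, ∑ i, convV i j = 0 := by decide +kernel
  simp only [Matrix.mulVec, dotProduct]
  rw [Finset.sum_comm]
  simp [← Finset.sum_mul, h]

/-- Translation of functions by a permutation intertwines `convU` up to the character. -/
lemma convU_mulVec_comp (g : A4) (f : Functions) :
    convU.mulVec (fun i => f (g.1⁻¹ i)) =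
      character g • fun i => (convU.mulVec f) (g.1⁻¹ i) := by
  funext i
  simp only [Matrix.mulVec, dotProduct, Pi.smul_apply, smul_eq_mul, Finset.mul_sum]
  rw [← Equiv.sum_comp g.1]
  refine Finset.sum_congr rfl fun j _ => ?_
  simp only [convU, Matrix.of_apply, point_sub_apply,
    show g.1⁻¹ (g.1 j) = j by simp]
  ring

lemma convV_mulVec_comp (g : A4) (f : Functions) :
    convV.mulVec (fun i => f (g.1⁻¹ i)) =
      character g ^ 2 • fun i => (convV.mulVec f) (g.1⁻¹ i) := by
  funext i
  simp only [Matrix.mulVec, dotProduct, Pi.smul_apply, smul_eq_mul, Finset.mul_sum]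
  rw [← Equiv.sum_comp g.1]
  refine Finset.sum_congr rfl fun j _ => ?_
  simp only [convV, Matrix.of_apply, point_sub_apply,
    show g.1⁻¹ (g.1 j) = j by simp]
  ring

/-- Higman's criterion: a representation with projective underlying module is projective as soon
as the identity is the sum of the conjugates of a linear endomorphism. -/
lemma projective_of_sum_conj {k G : Type} [CommRing k] [Group G] [Fintype G] (P : Rep.{0} k G)
    [Module.Projective k P] (φ : P →ₗ[k] P)
    (h : ∀ x, ∑ g, P.ρ g (φ (P.ρ g⁻¹ x)) = x) : Projective P where
  factors {E X} f e _ := by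
    obtain ⟨s, hs⟩ := Module.projective_lifting_property e.hom.toLinearMap f.hom.toLinearMap
      ((Rep.epi_iff_surjective e).1 inferInstance)
    have hs' (x : P) : e.hom (s x) = f.hom x := LinearMap.congr_fun hs x
    let t : P →ₗ[k] E := ∑ g : G, E.ρ g ∘ₗ s ∘ₗ φ ∘ₗ P.ρ g⁻¹
    have ht (x : P) : t x = ∑ g : G, E.ρ g (s (φ (P.ρ g⁻¹ x))) := by simp [t]
    refine ⟨Rep.ofHom (σ := E.ρ) (ρ := P.ρ) ⟨t, fun g => LinearMap.ext fun x => ?_⟩, ?_⟩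
    · simp only [LinearMap.comp_apply, ht, map_sum]
      rw [← Equiv.sum_comp (Equiv.mulLeft g)]
      refine Finset.sum_congr rfl fun c _ => ?_
      simp [Rep.ρ_mul, mul_inv_rev]
    · ext x
      change e.hom (t x) = f.hom x
      rw [ht, map_sum]
      conv_rhs => rw [← h x, map_sum]
      refine Finset.sum_congr rfl fun g _ => ?_
      rw [Rep.hom_comm_apply, hs', Rep.hom_comm_apply]

/-- The degree `n` term of the resolution: `n + 1` copies of the functions on four letters, the
copy indexed by `a` being twisted by the `(n + a)`-th power of the character. -/
noncomputable def termRep (n : ℕ) : Representation F4 A4 (Fin (n + 1) → Functions) where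
  toFun g :=
    { toFun := fun z a i => character g ^ (n + (a : ℕ)) * z a (g.1⁻¹ i)
      map_add' := fun y z => by
        funext a i
        simp [mul_add]
      map_smul' := fun c z => by
        funext a i
        simp only [Pi.smul_apply, smul_eq_mul, RingHom.id_apply]
        ring }
  map_one' := by
    refine LinearMap.ext fun z => ?_
    funext a i
    simp
  map_mul' g h := by
    refine LinearMap.ext fun z => ?_
    funext a i
    simp [mul_pow, mul_assoc]

lemma termRep_apply (n : ℕ) (g : A4) (z : Fin (n + 1) → Functions) (a : Fin (n + 1)) (i : Fin 4) :
    termRep n g z a i = character g ^ (n + (a : ℕ)) * z a (g.1⁻¹ i) := rfl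

/-- The degree `n` term of the resolution, as an object of `Rep`. -/
noncomputable abbrev term (n : ℕ) : Rep.{0} F4 A4 := Rep.of (termRep n)

instance projective_term (n : ℕ) : Projective (term n) := by
  have : Module.Projective F4 (term n) :=
    inferInstanceAs (Module.Projective F4 (Fin (n + 1) → Fin 4 → F4))
  refine projective_of_sum_conj (term n)
    { toFun := fun (z : Fin (n + 1) → Functions) a i => if i = 0 then z a i else 0
      map_add' := fun y z => by
        funext a i
        simp only [Pi.add_apply]
        split_ifs <;> simp
      map_smul' := fun c z => by
        funext a i
        simp only [Pi.smul_apply, RingHom.id_apply]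
        split_ifs <;> simp } fun z => ?_
  funext a i
  rw [Finset.sum_apply, Finset.sum_apply]
  trans ∑ g : A4, (if g.1⁻¹ i = 0 then (1 : F4) else 0) * z a i
  · refine Finset.sum_congr rfl fun g _ => ?_
    change character g ^ (n + (a : ℕ)) *
      (if g.1⁻¹ i = 0 then character g⁻¹ ^ (n + (a : ℕ)) * z a (g⁻¹.1⁻¹ (g.1⁻¹ i)) else 0) = _
    have h : character g * character g⁻¹ = 1 := by rw [← map_mul]; simp
    split_ifs
    · rw [← mul_assoc, ← mul_pow, h]
      simp
    · simp
  · rw [← Finset.sum_mul, card_stabilizer, one_mul]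

/-- The differential of the resolution on underlying modules. -/
noncomputable def differential (n : ℕ) :
    (Fin (n + 2) → Functions) →ₗ[F4] (Fin (n + 1) → Functions) where
  toFun z a := convU.mulVec (z a.succ) + convV.mulVec (z a.castSucc)
  map_add' y z := by
    funext a
    simp only [Pi.add_apply, Matrix.mulVec_add]
    abel
  map_smul' c z := by
    funext a
    simp only [Pi.smul_apply, Matrix.mulVec_smul, smul_add, RingHom.id_apply]

lemma differential_apply (n : ℕ) (z : Fin (n + 2) → Functions) (a : Fin (n + 1)) :
    differential n z a = convU.mulVec (z a.succ) + convV.mulVec (z a.castSucc) := rfl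

lemma differential_comp_differential (n : ℕ) (z : Fin (n + 3) → Functions) :
    differential n (differential (n + 1) z) = 0 := by
  funext a
  simp only [differential_apply, Matrix.mulVec_add, Matrix.mulVec_mulVec, convU_mul_self,
    convV_mul_self, convU_mul_convV, Matrix.zero_mulVec, zero_add, add_zero, Fin.succ_castSucc,
    Pi.zero_apply]
  exact CharTwo.add_self_eq_zero _

lemma termRep_eq_smul (n : ℕ) (g : A4) (z : Fin (n + 1) → Functions) (a : Fin (n + 1)) :
    termRep n g z a = character g ^ (n + (a : ℕ)) • fun i => z a (g.1⁻¹ i) := rfl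

lemma differential_termRep (n : ℕ) (g : A4) (z : Fin (n + 2) → Functions) :
    differential n (termRep (n + 1) g z) = termRep n g (differential n z) := by
  funext a
  have h3 := character_pow_three g
  have hU : character g ^ (n + 1 + (a.succ : ℕ)) * character g = character g ^ (n + (a : ℕ)) := by
    rw [← pow_succ, Fin.val_succ, show n + 1 + (a + 1) + 1 = n + a + 3 by ring, pow_add, h3,
      mul_one]
  have hV : character g ^ (n + 1 + (a.castSucc : ℕ)) * character g ^ 2 =
      character g ^ (n + (a : ℕ)) := by
    rw [← pow_add, Fin.val_castSucc, show n + 1 + a + 2 = n + a + 3 by ring, pow_add, h3, mul_one]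
  rw [differential_apply, termRep_eq_smul, termRep_eq_smul, termRep_eq_smul, Matrix.mulVec_smul,
    Matrix.mulVec_smul, convU_mulVec_comp, convV_mulVec_comp, smul_smul, smul_smul, hU, hV,
    ← smul_add]
  rfl

/-- The differential of the resolution. -/
noncomputable def differentialHom (n : ℕ) : term (n + 1) ⟶ term n :=
  Rep.ofHom ⟨differential n, fun g => LinearMap.ext fun z => differential_termRep n g z⟩

/-- A chain is a boundary as soon as its components satisfy the equations of a cycle; the last
hypothesis takes care of the component of index `0`. -/
lemma exists_differential_eq (n : ℕ) (z : Fin (n + 1) → Functions)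
    (hz : ∀ a : Fin n, convU.mulVec (z a.succ) = convV.mulVec (z a.castSucc))
    (hz₀ : (convV * convU).mulVec (z 0) = 0) :
    ∃ w, differential n w = z := by
  let w : Fin (n + 2) → Functions := Fin.cons ((homotopyV * (homotopyU * convU)).mulVec (z 0))
    fun a => homotopyU.mulVec (z a)
  have hw (a : Fin (n + 1)) : w a.succ = homotopyU.mulVec (z a) := rfl
  have h (a : Fin (n + 1)) :
      convV.mulVec (w a.castSucc) = homotopyU.mulVec (convU.mulVec (z a)) := by
    refine Fin.cases ?_ (fun b => ?_) a
    · change convV.mulVec ((homotopyV * (homotopyU * convU)).mulVec (z 0)) = _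
      rw [Matrix.mulVec_mulVec, ← mul_assoc, convV_mul_homotopyV, add_mul, one_mul, mul_assoc,
        ← mul_assoc convV, convV_mul_homotopyU, Matrix.add_mulVec, mul_assoc homotopyU,
        ← Matrix.mulVec_mulVec, ← Matrix.mulVec_mulVec, ← Matrix.mulVec_mulVec, hz₀]
      simp
    · rw [← Fin.succ_castSucc, hw, hz, Matrix.mulVec_mulVec, convV_mul_homotopyU,
        ← Matrix.mulVec_mulVec]
  refine ⟨w, ?_⟩
  funext a
  rw [differential_apply, hw, Matrix.mulVec_mulVec, convU_mul_homotopyU, Matrix.add_mulVec,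
    Matrix.one_mulVec, ← Matrix.mulVec_mulVec, h]
  funext i
  exact CharTwo.add_cancel_right _ _

lemma differential_exact (n : ℕ) (z : Fin (n + 2) → Functions) (hz : differential n z = 0) :
    ∃ w, differential (n + 1) w = z := by
  have h (a : Fin (n + 1)) : convU.mulVec (z a.succ) = convV.mulVec (z a.castSucc) :=
    CharTwo.add_eq_zero.1 (congrFun hz a)
  refine exists_differential_eq (n + 1) z h ?_
  have h₀ := h 0
  rw [Fin.castSucc_zero] at h₀
  rw [← convU_mul_convV, ← Matrix.mulVec_mulVec, ← h₀, Matrix.mulVec_mulVec, convU_mul_self,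
    Matrix.zero_mulVec]

/-- The augmentation of the resolution on underlying modules. -/
noncomputable def augmentation : (Fin 1 → Functions) →ₗ[F4] F4 where
  toFun z := ∑ i, z 0 i
  map_add' y z := Finset.sum_add_distrib
  map_smul' c z := by simp [Finset.mul_sum]

lemma augmentation_apply (z : Fin 1 → Functions) : augmentation z = ∑ i, z 0 i := rfl

lemma augmentation_termRep (g : A4) (z : Fin 1 → Functions) :
    augmentation (termRep 0 g z) = augmentation z := by
  simp only [augmentation_apply, termRep_apply, Fin.val_zero, add_zero, pow_zero, one_mul]
  exact Equiv.sum_comp g.1⁻¹ (z 0)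

lemma augmentation_differential (z : Fin 2 → Functions) : augmentation (differential 0 z) = 0 := by
  simp only [augmentation_apply, differential_apply, Pi.add_apply, Finset.sum_add_distrib,
    sum_convU, sum_convV, add_zero]

lemma augmentation_exact (z : Fin 1 → Functions) (hz : augmentation z = 0) :
    ∃ w, differential 0 w = z := by
  refine exists_differential_eq 0 z (fun a => a.elim0) ?_
  funext i
  simpa [convV_mul_convU, Matrix.mulVec, dotProduct, augmentation_apply] using hz

/-- The augmentation of the resolution. -/
noncomputable def augmentationHom : term 0 ⟶ Rep.trivial F4 A4 F4 :=
  Rep.ofHom ⟨augmentation, fun g => LinearMap.ext fun z => augmentation_termRep g z⟩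

/-- The complex underlying the resolution. -/
noncomputable def resolutionComplex : ChainComplex (Rep.{0} F4 A4) ℕ :=
  ChainComplex.of term differentialHom fun n => by
    refine Rep.hom_ext (Representation.IntertwiningMap.ext (LinearMap.ext fun z => ?_))
    exact differential_comp_differential n z

lemma resolutionComplex_d (n : ℕ) : resolutionComplex.d (n + 1) n = differentialHom n :=
  ChainComplex.of_d ..

/-- The augmentation of the resolution, as a map of complexes. -/
noncomputable def resolutionπ :
    resolutionComplex ⟶ (ChainComplex.single₀ (Rep.{0} F4 A4)).obj (Rep.trivial F4 A4 F4) :=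
  (resolutionComplex.toSingle₀Equiv _).symm ⟨augmentationHom, by
    rw [resolutionComplex_d]
    refine Rep.hom_ext (Representation.IntertwiningMap.ext (LinearMap.ext fun z => ?_))
    exact augmentation_differential z⟩

lemma resolutionπ_f_zero : resolutionπ.f 0 = augmentationHom :=
  ChainComplex.toSingle₀Equiv_symm_apply_f_zero ..

instance : QuasiIso resolutionπ where
  quasiIsoAt m := by
    cases m with
    | zero =>
      rw [ChainComplex.quasiIsoAt₀_iff, ShortComplex.quasiIso_iff_of_zeros' _ rfl rfl rfl]
      constructor
      · apply (forget₂ _ (ModuleCat F4)).reflects_exact_of_faithful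
        rw [ShortComplex.moduleCat_exact_iff]
        intro z hz
        change (resolutionπ.f 0).hom z = 0 at hz
        rw [resolutionπ_f_zero] at hz
        obtain ⟨w, hw⟩ := augmentation_exact z hz
        refine ⟨w, ?_⟩
        change (resolutionComplex.d 1 0).hom w = z
        rw [resolutionComplex_d]
        exact hw
      · rw [Rep.epi_iff_surjective]
        intro (x : F4)
        change ∃ z, (resolutionπ.f 0).hom z = x
        rw [resolutionπ_f_zero]
        exact ⟨fun _ => Pi.single 0 x, by
          change augmentation _ = x
          simp [augmentation_apply]⟩
    | succ m =>
      rw [quasiIsoAt_iff_exactAt' (hL := ChainComplex.exactAt_succ_single_obj ..),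
          HomologicalComplex.exactAt_iff' _ (m + 2) (m + 1) m (by simp) (by simp)]
      apply (forget₂ _ (ModuleCat F4)).reflects_exact_of_faithful
      rw [ShortComplex.moduleCat_exact_iff]
      intro z hz
      change (resolutionComplex.d (m + 1) m).hom z = 0 at hz
      rw [resolutionComplex_d] at hz
      obtain ⟨w, hw⟩ := differential_exact m z hz
      refine ⟨w, ?_⟩
      change (resolutionComplex.d (m + 2) (m + 1)).hom w = z
      rw [resolutionComplex_d]
      exact hw

/-- A projective resolution of the trivial representation of `A₄`. -/
noncomputable def resolution : ProjectiveResolution (Rep.trivial F4 A4 F4) where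
  complex := resolutionComplex
  projective := projective_term
  π := resolutionπ

open scoped TensorProduct

open Rep in
/-- The class of an element of `term n` in the coinvariants of `F4 ⊗ term n`. -/
noncomputable def coinvariantClass (n : ℕ) :
    (Fin (n + 1) → Functions) →ₗ[F4]
      ((coinvariantsTensor F4 A4).obj (Rep.trivial F4 A4 F4)).obj (term n) :=
  coinvariantsTensorMk (Rep.trivial F4 A4 F4) (term n) 1

lemma coinvariantsTensorMk_eq (n : ℕ) (c : F4) (z : Fin (n + 1) → Functions) :
    Rep.coinvariantsTensorMk (Rep.trivial F4 A4 F4) (term n) c z = c • coinvariantClass n z := by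
  have h := map_smul (Rep.coinvariantsTensorMk (Rep.trivial F4 A4 F4) (term n)) c (1 : F4)
  rw [smul_eq_mul, mul_one] at h
  exact LinearMap.congr_fun h z

lemma coinvariantClass_surjective (n : ℕ) : Function.Surjective (coinvariantClass n) := by
  intro x
  induction x using Representation.Coinvariants.induction_on with | h y => ?_
  induction y using TensorProduct.induction_on with
  | zero => exact ⟨0, by simp⟩
  | tmul c z =>
    exact ⟨c • z, by rw [map_smul]; exact (coinvariantsTensorMk_eq n c z).symm⟩
  | add y y' hy hy' =>
    obtain ⟨z, hz⟩ := hy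
    obtain ⟨z', hz'⟩ := hy'
    exact ⟨z + z', by rw [map_add, map_add, hz, hz']⟩

lemma coinvariantClass_termRep (n : ℕ) (g : A4) (z : Fin (n + 1) → Functions) :
    coinvariantClass n (termRep n g z) = coinvariantClass n z :=
  Representation.Coinvariants.mk_self_apply
    ((Rep.trivial F4 A4 F4).ρ.tprod (term n).ρ) g ((1 : F4) ⊗ₜ[F4] z)

lemma termRep_single (n : ℕ) (g : A4) (a : Fin (n + 1)) (i : Fin 4) :
    termRep n g (Pi.single a (Pi.single i 1)) =
      character g ^ (n + (a : ℕ)) • Pi.single a (Pi.single (g.1 i) 1) := by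
  funext b j
  rw [termRep_apply, Pi.smul_apply, Pi.smul_apply, smul_eq_mul]
  rcases eq_or_ne b a with rfl | h
  · simp only [Pi.single_eq_same, Pi.single_apply, Equiv.Perm.inv_eq_iff_eq]
  · simp [h]

lemma coinvariantClass_single (n : ℕ) (a : Fin (n + 1)) (i : Fin 4) :
    coinvariantClass n (Pi.single a (Pi.single i 1)) =
      coinvariantClass n (Pi.single a (Pi.single 0 1)) := by
  obtain ⟨g, rfl, hg⟩ := exists_translation i
  rw [← coinvariantClass_termRep n g (Pi.single a (Pi.single 0 1)), termRep_single, hg, one_pow,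
    one_smul]

lemma coinvariantClass_single_eq_zero (n : ℕ) (a : Fin (n + 1)) (h : ¬ 3 ∣ n + (a : ℕ)) :
    coinvariantClass n (Pi.single a (Pi.single 0 1)) = 0 := by
  obtain ⟨g, hg₀, hg⟩ := exists_homothety
  have key := coinvariantClass_termRep n g (Pi.single a (Pi.single 0 1))
  rw [termRep_single, hg₀, map_smul] at key
  have hunit : ∃ c : F4, c * (character g ^ (n + (a : ℕ)) - 1) = 1 := by
    rw [← Nat.div_add_mod (n + (a : ℕ)) 3, pow_add, pow_mul, character_pow_three, one_pow, one_mul,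
      hg]
    have : (n + (a : ℕ)) % 3 = 1 ∨ (n + (a : ℕ)) % 3 = 2 := by omega
    rcases this with h | h <;> rw [h]
    · exact ⟨⟨0, 1⟩, by decide⟩
    · exact ⟨⟨1, 1⟩, by decide⟩
  obtain ⟨c, hc⟩ := hunit
  have := congrArg (· • coinvariantClass n (Pi.single a (Pi.single 0 1))) hc
  simpa [mul_smul, sub_smul, key] using this.symm

lemma coinvariantClass_eq_sum (n : ℕ) (z : Fin (n + 1) → Functions) :
    coinvariantClass n z =
      ∑ a, (∑ i, z a i) • coinvariantClass n (Pi.single a (Pi.single 0 1)) := by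
  have hz : z = ∑ a, ∑ i, z a i • Pi.single a (Pi.single i 1) := by
    funext b j
    simp [Finset.sum_apply, Pi.single_apply, apply_ite, ite_apply]
  conv_lhs => rw [hz]
  simp only [map_sum, map_smul, coinvariantClass_single, Finset.sum_smul]

lemma coinvariantClass_differential (n : ℕ) (z : Fin (n + 2) → Functions) :
    coinvariantClass n (differential n z) = 0 := by
  rw [coinvariantClass_eq_sum]
  simp [differential_apply, Finset.sum_add_distrib, sum_convU, sum_convV]

/-- Summing the values of a function on the copies with trivial twist. -/
noncomputable def sumValues (n : ℕ) :
    (Fin (n + 1) → Functions) →ₗ[F4] ({a : Fin (n + 1) // 3 ∣ n + (a : ℕ)} → F4) where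
  toFun z a := ∑ i, z a.1 i
  map_add' y z := by
    funext a
    exact Finset.sum_add_distrib
  map_smul' c z := by
    funext a
    simp [Finset.mul_sum]

lemma sumValues_termRep (n : ℕ) (g : A4) (z : Fin (n + 1) → Functions) :
    sumValues n (termRep n g z) = sumValues n z := by
  funext ⟨a, m, hm⟩
  change ∑ i, character g ^ (n + (a : ℕ)) * z a (g.1⁻¹ i) = ∑ i, z a i
  rw [hm, pow_mul, character_pow_three, one_pow]
  simp only [one_mul]
  exact Equiv.sum_comp g.1⁻¹ (z a)

open Rep in
/-- The map induced by `sumValues` on coinvariants. -/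
noncomputable def coinvariantsSum (n : ℕ) :
    (((coinvariantsTensor F4 A4).obj (Rep.trivial F4 A4 F4)).obj (term n) : Type) →ₗ[F4]
      ({a : Fin (n + 1) // 3 ∣ n + (a : ℕ)} → F4) :=
  Representation.Coinvariants.lift _
    (TensorProduct.lift ((LinearMap.lsmul F4 _).compl₂ (sumValues n))) fun g =>
      TensorProduct.ext' fun c z => congrArg (c • ·) (sumValues_termRep n g z)

lemma coinvariantsSum_coinvariantClass (n : ℕ) (z : Fin (n + 1) → Functions) :
    coinvariantsSum n (coinvariantClass n z) = sumValues n z :=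
  one_smul F4 (sumValues n z)

lemma coinvariantsSum_bijective (n : ℕ) : Function.Bijective (coinvariantsSum n) := by
  constructor
  · rw [injective_iff_map_eq_zero]
    intro x hx
    obtain ⟨z, rfl⟩ := coinvariantClass_surjective n x
    rw [coinvariantsSum_coinvariantClass] at hx
    rw [coinvariantClass_eq_sum]
    refine Finset.sum_eq_zero fun a _ => ?_
    by_cases ha : 3 ∣ n + (a : ℕ)
    · have h : ∑ i, z a i = 0 := congrFun hx ⟨a, ha⟩
      rw [h, zero_smul]
    · rw [coinvariantClass_single_eq_zero n a ha, smul_zero]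
  · intro v
    refine ⟨coinvariantClass n fun a =>
      Pi.single 0 (if ha : 3 ∣ n + (a : ℕ) then v ⟨a, ha⟩ else 0), ?_⟩
    rw [coinvariantsSum_coinvariantClass]
    funext a
    change ∑ i, (Pi.single 0 _ : Functions) i = v a
    simp [a.2]

/-- The number of copies of trivial twist in degree `n` of the resolution. -/
noncomputable def multiplicity (n : ℕ) : ℕ := Nat.card {a : Fin (n + 1) // 3 ∣ n + (a : ℕ)}

lemma coinvariants_d_eq_zero (i j : ℕ) :
    (resolution.complex.coinvariantsTensorObj (Rep.trivial F4 A4 F4)).d i j = 0 := by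
  by_cases h : (ComplexShape.down ℕ).Rel i j
  · obtain rfl : j + 1 = i := h
    change ((Rep.coinvariantsTensor F4 A4).obj (Rep.trivial F4 A4 F4)).map
      (resolutionComplex.d (j + 1) j) = 0
    rw [resolutionComplex_d]
    refine Rep.coinvariantsTensor_hom_ext (LinearMap.ext fun c => LinearMap.ext fun z => ?_)
    change Rep.coinvariantsTensorMk (Rep.trivial F4 A4 F4) (term j) c (differential j z) = 0
    rw [coinvariantsTensorMk_eq]
    exact (congrArg (c • ·) (coinvariantClass_differential j z)).trans (smul_zero c)
  · exact HomologicalComplex.shape _ _ _ h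

lemma card_groupHomology (n : ℕ) :
    Nat.card (groupHomology (Rep.trivial F4 A4 F4) n) = 4 ^ multiplicity n := by
  let K := resolution.complex.coinvariantsTensorObj (Rep.trivial F4 A4 F4)
  have hK := coinvariants_d_eq_zero
  have := K.isIso_iCycles n _ rfl (hK _ _)
  have := K.isIso_homologyπ _ n rfl (hK _ _)
  let e := groupHomologyIso (Rep.trivial F4 A4 F4) n resolution ≪≫ (asIso (K.homologyπ n)).symm ≪≫
    asIso (K.iCycles n)
  rw [Nat.card_congr e.toLinearEquiv.toEquiv]
  change Nat.card (((Rep.coinvariantsTensor F4 A4).obj (Rep.trivial F4 A4 F4)).obj (term n)) = _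
  rw [Nat.card_congr (Equiv.ofBijective _ (coinvariantsSum_bijective n)), Nat.card_fun, card_F4]
  rfl

/-- The number of elements of a subquotient `N / range f`, in terms of kernels. -/
lemma card_quotient_range_mul {k X Y : Type*} [Ring k] [AddCommGroup X] [AddCommGroup Y]
    [Module k X] [Module k Y] (f : X →ₗ[k] Y) (N : Submodule k Y)
    (h : LinearMap.range f ≤ N) :
    Nat.card (N ⧸ (LinearMap.range f).comap N.subtype) * Nat.card X =
      Nat.card N * Nat.card (LinearMap.ker f) := by
  rw [Submodule.card_eq_card_quotient_mul_card (LinearMap.ker f),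
    Submodule.card_eq_card_quotient_mul_card ((LinearMap.range f).comap N.subtype),
    Nat.card_congr f.quotKerEquivRange.toEquiv,
    Nat.card_congr (Submodule.comapSubtypeEquivOfLe h).toEquiv]
  ring

lemma card_shortComplex_homology_mul {k : Type} [Ring k] (S : ShortComplex (ModuleCat.{0} k)) :
    Nat.card S.homology * Nat.card S.X₁ =
      Nat.card (LinearMap.ker S.g.hom) * Nat.card (LinearMap.ker S.f.hom) := by
  rw [Nat.card_congr S.moduleCatHomologyIso.toLinearEquiv.toEquiv]
  have key := card_quotient_range_mul S.f.hom (LinearMap.ker S.g.hom) (by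
    rintro _ ⟨x, rfl⟩
    exact S.moduleCat_zero_apply x)
  have hrange : LinearMap.range S.moduleCatToCycles =
      (LinearMap.range S.f.hom).comap (LinearMap.ker S.g.hom).subtype :=
    LinearMap.range_codRestrict _ _ _
  rw [← hrange] at key
  exact key

lemma card_homology_mul {k : Type} [Ring k] (K : ChainComplex (ModuleCat.{0} k) ℕ) (n : ℕ) :
    Nat.card (K.homology (n + 1)) * Nat.card (K.X (n + 2)) =
      Nat.card (LinearMap.ker (K.d (n + 1) n).hom) *
        Nat.card (LinearMap.ker (K.d (n + 2) (n + 1)).hom) := by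
  rw [Nat.card_congr
    (K.homologyIsoSc' (n + 2) (n + 1) n (by simp) (by simp)).toLinearEquiv.toEquiv]
  exact card_shortComplex_homology_mul (K.sc' (n + 2) (n + 1) n)

section Comparison

variable {k G : Type} [CommRing k] [Group G]

lemma bar_d_comp_d (n : ℕ) (x : chains G k (n + 2)) :
    BarHomology.d k G k n (BarHomology.d k G k (n + 1) x) = 0 :=
  congrArg (fun f => f.hom x)
    (groupHomology.inhomogeneousChains.d_comp_d (Rep.trivial k G k) n)

lemma bar_d_int (n : ℕ) (x : chains G k (n + 1)) :
    BarHomology.d ℤ G k n x = BarHomology.d k G k n x := by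
  induction x using Finsupp.induction_linear with
  | zero => simp
  | add x y hx hy => rw [map_add, map_add, hx, hy]
  | single g a =>
    simp only [BarHomology.d, Finsupp.lsum_single, LinearMap.add_apply, LinearMap.sum_apply,
      LinearMap.smul_apply, Finsupp.lsingle_apply]
    congr 1
    refine Finset.sum_congr rfl fun j _ => ?_
    rcases Nat.even_or_odd ((j : ℕ) + 1) with h' | h' <;> simp [h'.neg_one_pow]

/-- Naturality of the bar differential in the coefficients. -/
lemma bar_d_mapRange {A B : Type} [AddCommGroup A] [AddCommGroup B] (φ : A →+ B) (n : ℕ)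
    (x : chains G A (n + 1)) :
    BarHomology.d ℤ G B n (Finsupp.mapRange.addMonoidHom φ x) =
      Finsupp.mapRange.addMonoidHom φ (BarHomology.d ℤ G A n x) := by
  induction x using Finsupp.induction_linear with
  | zero => simp
  | add x y hx hy => simp only [map_add, hx, hy]
  | single g a =>
    have hs (m : ℕ) (h : Fin m → G) : Finsupp.mapRange.addMonoidHom φ (Finsupp.single h a) =
        Finsupp.single h (φ a) := Finsupp.mapRange_single (hf := φ.map_zero)
    simp only [hs, BarHomology.d, Finsupp.lsum_single, LinearMap.add_apply, LinearMap.sum_apply,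
      LinearMap.smul_apply, Finsupp.lsingle_apply, map_add, map_sum, map_zsmul]

/-- The number of homology classes in positive degrees, in terms of cycles. -/
lemma card_barHomology_mul (n : ℕ) :
    Nat.card (BarHomology.GroupHomology ℤ G k (n + 1)) * Nat.card (chains G k (n + 2)) =
      Nat.card (LinearMap.ker (BarHomology.d ℤ G k n)) *
        Nat.card (LinearMap.ker (BarHomology.d ℤ G k (n + 1))) := by
  refine card_quotient_range_mul (BarHomology.d ℤ G k (n + 1))
    (LinearMap.ker (BarHomology.d ℤ G k n)) ?_
  rintro _ ⟨x, rfl⟩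
  rw [LinearMap.mem_ker, bar_d_int, bar_d_int, bar_d_comp_d]

/-- The analogue of `card_barHomology_mul` for `groupHomology`. -/
lemma card_groupHomology_mul (n : ℕ) :
    Nat.card (groupHomology (Rep.trivial k G k) (n + 1)) * Nat.card (chains G k (n + 2)) =
      Nat.card (LinearMap.ker (BarHomology.d ℤ G k n)) *
        Nat.card (LinearMap.ker (BarHomology.d ℤ G k (n + 1))) := by
  have hker (m : ℕ) : Nat.card (LinearMap.ker (BarHomology.d ℤ G k m)) =
      Nat.card (LinearMap.ker (BarHomology.d k G k m)) :=
    Nat.card_congr (Equiv.subtypeEquivRight fun x => by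
      rw [LinearMap.mem_ker, LinearMap.mem_ker, bar_d_int])
  have hd (m : ℕ) : Nat.card (LinearMap.ker
      ((groupHomology.inhomogeneousChains (Rep.trivial k G k)).d (m + 1) m).hom) =
        Nat.card (LinearMap.ker (BarHomology.d k G k m)) := by
    rw [groupHomology.inhomogeneousChains.d_def]
    rfl
  rw [hker, hker, ← hd, ← hd]
  exact card_homology_mul (groupHomology.inhomogeneousChains (Rep.trivial k G k)) n

end Comparison

/-- The first coordinate on `F4`. -/
def reHom : F4 →+ ZMod 2 := ⟨⟨fun x => x.re, rfl⟩, fun _ _ => rfl⟩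

/-- The second coordinate on `F4`. -/
def imHom : F4 →+ ZMod 2 := ⟨⟨fun x => x.im, rfl⟩, fun _ _ => rfl⟩

/-- The inclusion of the first coordinate axis in `F4`. -/
def reInv : ZMod 2 →+ F4 := ⟨⟨fun x => ⟨x, 0⟩, rfl⟩, by decide⟩

/-- The inclusion of the second coordinate axis in `F4`. -/
def imInv : ZMod 2 →+ F4 := ⟨⟨fun x => ⟨0, x⟩, rfl⟩, by decide⟩

/-- The two coordinates of a chain with coefficients in `F4`. -/
noncomputable def chainsEquivProd (G : Type) (n : ℕ) :
    chains G F4 n ≃ chains G (ZMod 2) n × chains G (ZMod 2) n where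
  toFun x := (Finsupp.mapRange.addMonoidHom reHom x, Finsupp.mapRange.addMonoidHom imHom x)
  invFun p := Finsupp.mapRange.addMonoidHom reInv p.1 + Finsupp.mapRange.addMonoidHom imInv p.2
  left_inv x := by
    ext g <;> simp [reHom, imHom, reInv, imInv]
  right_inv p := by
    ext g <;> simp [reHom, imHom, reInv, imInv]

lemma card_chains (G : Type) (n : ℕ) :
    Nat.card (chains G F4 n) = Nat.card (chains G (ZMod 2) n) ^ 2 := by
  rw [Nat.card_congr (chainsEquivProd G n), Nat.card_prod, sq]

lemma card_ker_bar_d (G : Type) [Group G] (n : ℕ) :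
    Nat.card (LinearMap.ker (BarHomology.d ℤ G F4 n)) =
      Nat.card (LinearMap.ker (BarHomology.d ℤ G (ZMod 2) n)) ^ 2 := by
  have h (x : chains G F4 (n + 1)) : x ∈ LinearMap.ker (BarHomology.d ℤ G F4 n) ↔
      (chainsEquivProd G (n + 1) x).1 ∈ LinearMap.ker (BarHomology.d ℤ G (ZMod 2) n) ∧
      (chainsEquivProd G (n + 1) x).2 ∈ LinearMap.ker (BarHomology.d ℤ G (ZMod 2) n) := by
    simp only [LinearMap.mem_ker]
    rw [← (chainsEquivProd G n).apply_eq_iff_eq, Prod.ext_iff]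
    simp only [chainsEquivProd, Equiv.coe_fn_mk, bar_d_mapRange, map_zero]
  rw [Nat.card_congr (((chainsEquivProd G (n + 1)).subtypeEquiv h).trans
    Equiv.subtypeProdEquivProd), Nat.card_prod, sq]

lemma card_groupHomology_F4 (G : Type) [Group G] [Finite G] (n : ℕ) :
    Nat.card (groupHomology (Rep.trivial F4 G F4) (n + 1)) =
      Nat.card (BarHomology.GroupHomology ℤ G (ZMod 2) (n + 1)) ^ 2 := by
  have h4 := card_groupHomology_mul (k := F4) (G := G) n
  have h2 := card_barHomology_mul (k := ZMod 2) (G := G) n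
  rw [card_chains, card_ker_bar_d, card_ker_bar_d, ← mul_pow, ← h2, mul_pow] at h4
  have : Finite (chains G (ZMod 2) (n + 2)) := Finite.of_injective _ DFunLike.coe_injective
  exact Nat.eq_of_mul_eq_mul_right (pow_pos Nat.card_pos 2) h4

lemma card_barHomology (n : ℕ) :
    Nat.card (BarHomology.GroupHomology ℤ A4 (ZMod 2) (n + 1)) = 2 ^ multiplicity (n + 1) := by
  have h := card_groupHomology_F4 A4 n
  have h4 : 4 ^ multiplicity (n + 1) = (2 ^ multiplicity (n + 1)) ^ 2 := by
    rw [← pow_mul, mul_comm, pow_mul]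
    norm_num
  rw [card_groupHomology, h4] at h
  exact (Nat.pow_left_injective two_ne_zero h).symm

lemma count_three_dvd_add (n m : ℕ) :
    Nat.count (fun a => 3 ∣ n + a) m = (n + m + 2) / 3 - (n + 2) / 3 := by
  induction m with
  | zero => simp
  | succ m ih =>
    rw [Nat.count_succ, ih]
    split_ifs <;> omega

lemma multiplicity_eq (n : ℕ) : multiplicity n = (2 * n + 3) / 3 - (n + 2) / 3 := by
  let e : {a : Fin (n + 1) // 3 ∣ n + (a : ℕ)} ≃ {a : ℕ // a < n + 1 ∧ 3 ∣ n + a} :=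
    ⟨fun a => ⟨a.1, a.1.2, a.2⟩, fun a => ⟨⟨a.1, a.2.1⟩, a.2.2⟩, fun _ => rfl, fun _ => rfl⟩
  let _ := Nat.CountSet.fintype (fun a => 3 ∣ n + a) (n + 1)
  rw [multiplicity, Nat.card_congr e, Nat.card_eq_fintype_card, ← Nat.count_eq_card_fintype,
    count_three_dvd_add, two_mul]
  rfl

/-- A finite abelian group of exponent two is determined by its cardinality. -/
lemma nonempty_addEquiv_of_card {M : Type*} [AddCommGroup M] (h : ∀ x : M, 2 • x = 0) {m : ℕ}
    (hcard : Nat.card M = 2 ^ m) : Nonempty (M ≃+ (Fin m → ZMod 2)) := by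
  let _ : Module (ZMod 2) M := AddCommGroup.zmodModule h
  have : Finite M := Nat.finite_of_card_ne_zero (by rw [hcard]; positivity)
  have hrank : Module.finrank (ZMod 2) M = m := by
    have := Module.natCard_eq_pow_finrank (K := ZMod 2) (V := M)
    rw [hcard, Nat.card_zmod] at this
    exact (Nat.pow_right_injective le_rfl this).symm
  exact ⟨(LinearEquiv.ofFinrankEq M (Fin m → ZMod 2) (by
    rw [hrank, Module.finrank_fin_fun])).toAddEquiv⟩

lemma two_nsmul_barHomology (G : Type) [Group G] (n : ℕ)
    (x : BarHomology.GroupHomology ℤ G (ZMod 2) n) : 2 • x = 0 := by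
  induction x using Submodule.Quotient.induction_on with | _ x => ?_
  rw [← Submodule.Quotient.mk_smul]
  have : 2 • x = 0 := by
    ext g
    simp [two_mul, CharTwo.add_self_eq_zero]
  rw [this, Submodule.Quotient.mk_zero]

lemma nonempty_barHomology_addEquiv (n m : ℕ) (h : multiplicity (n + 1) = m) :
    Nonempty (BarHomology.GroupHomology ℤ A4 (ZMod 2) (n + 1) ≃+ (Fin m → ZMod 2)) :=
  nonempty_addEquiv_of_card (two_nsmul_barHomology A4 _) (by rw [card_barHomology, h])

end AlternatingFour

/-- The homology of the alternating group `A₄` with trivial `ℤ/2`-coefficients. -/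
theorem homology_A4_mod2 (k : ℕ) :
    Nonempty (GroupHomology ℤ (↥(alternatingGroup (Fin 4))) (ZMod 2) (6 * k + 1) ≃+ (Fin (2 * k) → ZMod 2)) ∧
    Nonempty (GroupHomology ℤ (↥(alternatingGroup (Fin 4))) (ZMod 2) (6 * k + 2) ≃+ (Fin (2 * k + 1) → ZMod 2)) ∧
    Nonempty (GroupHomology ℤ (↥(alternatingGroup (Fin 4))) (ZMod 2) (6 * k + 3) ≃+ (Fin (2 * k + 2) → ZMod 2)) ∧
    Nonempty (GroupHomology ℤ (↥(alternatingGroup (Fin 4))) (ZMod 2) (6 * k + 4) ≃+ (Fin (2 * k + 1) → ZMod 2)) ∧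
    Nonempty (GroupHomology ℤ (↥(alternatingGroup (Fin 4))) (ZMod 2) (6 * k + 5) ≃+ (Fin (2 * k + 2) → ZMod 2)) ∧
    Nonempty (GroupHomology ℤ (↥(alternatingGroup (Fin 4))) (ZMod 2) (6 * k + 6) ≃+ (Fin (2 * k + 3) → ZMod 2)) := by
  refine ⟨?_, ?_, ?_, ?_, ?_, ?_⟩ <;>
  · refine AlternatingFour.nonempty_barHomology_addEquiv _ _ ?_
    rw [AlternatingFour.multiplicity_eq]
    omega
end

section
/- Let C be any of the trivial coefficient modules ℤ, ℤ/2, ℤ/3, ℤ/4. An injective group homomorphism ℤ/3 → S_3 induces an injection H_q(ℤ/3; C) → H_q(S_3; C) on group homology in every degree q ≥ 1 congruent to 3 or 0 modulo 4, and induces the zero map on H_q in every other degree q ≥ 1. -/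
namespace BarHomology

open Finsupp

/-- The action of `ℤ` on finitely supported functions coming from the coefficients, preferred to
the one coming from the additive group structure. -/
noncomputable abbrev finsuppIntModule (X A : Type) [AddCommGroup A] [Module ℤ A] :
    Module ℤ (X →₀ A) :=
  Finsupp.module X A

attribute [local instance] finsuppIntModule

/-- The augmentation `ℤ[X] → ℤ` sending every basis element to `1`. -/
noncomputable def aug (X : Type) : (X →₀ ℤ) →ₗ[ℤ] ℤ := Finsupp.lsum ℤ fun _ => LinearMap.id

@[simp]
lemma aug_single {X : Type} (x : X) (a : ℤ) : aug X (single x a) = a := by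
  simp [aug]

lemma aug_lmapDomain {X Y : Type} (f : X → Y) (x : X →₀ ℤ) :
    aug Y (lmapDomain ℤ ℤ f x) = aug X x := by
  have : aug Y ∘ₗ lmapDomain ℤ ℤ f = aug X := by
    ext; simp
  exact LinearMap.congr_fun this x

/-- A resolution of the trivial `G`-module `ℤ` by permutation modules on free `G`-sets. -/
structure FreeRes (G : Type) [Group G] where
  X : ℕ → Type
  act : ∀ n, G →* Equiv.Perm (X n)
  act_free : ∀ n g x, act n g x = x → g = 1
  nonempty : Nonempty (X 0)
  d : ∀ n, (X (n + 1) →₀ ℤ) →ₗ[ℤ] (X n →₀ ℤ)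
  d_act : ∀ n g x,
    d n (lmapDomain ℤ ℤ (act (n + 1) g) x) = lmapDomain ℤ ℤ (act n g) (d n x)
  d_d : ∀ n x, d n (d (n + 1) x) = 0
  aug_d : ∀ x, aug (X 0) (d 0 x) = 0
  exact_zero : ∀ x, aug (X 0) x = 0 → ∃ y, d 0 y = x
  exact_succ : ∀ n x, d n x = 0 → ∃ y, d (n + 1) y = x

/-- Equivariant choice on a free `G`-set, extended linearly to the permutation module. -/
lemma exists_equivariant_linear {G X Y : Type} [Group G]
    (act : G →* Equiv.Perm X) (free : ∀ g x, act g x = x → g = 1)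
    (ρ : G →* ((Y →₀ ℤ) →ₗ[ℤ] (Y →₀ ℤ))) (p : X → (Y →₀ ℤ) → Prop)
    (hp : ∀ g x e, p x e → p (act g x) (ρ g e)) (hex : ∀ x, ∃ e, p x e) :
    ∃ f : (X →₀ ℤ) →ₗ[ℤ] (Y →₀ ℤ), (∀ x, p x (f (single x 1))) ∧
      ∀ g x, f (lmapDomain ℤ ℤ (act g) x) = ρ g (f x) := by
  let r : Setoid X :=
    { r := fun x y => ∃ g, act g x = y
      iseqv :=
        { refl := fun x => ⟨1, by simp⟩
          symm := by
            rintro x y ⟨g, rfl⟩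
            exact ⟨g⁻¹, by simp⟩
          trans := by
            rintro x y z ⟨g, rfl⟩ ⟨h, rfl⟩
            exact ⟨h * g, by simp⟩ } }
  have hout : ∀ x : X, ∃ g, act g (Quotient.mk r x).out = x :=
    fun x => Quotient.exact (Quotient.out_eq (Quotient.mk r x))
  choose γ hγ using hout
  choose e he using hex
  have hmk : ∀ g x, Quotient.mk r (act g x) = Quotient.mk r x :=
    fun g x => (Quotient.sound (s := r) ⟨g, rfl⟩).symm
  have hγ_act : ∀ g x, γ (act g x) = g * γ x := by
    intro g x
    have h₁ := hγ (act g x)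
    rw [hmk] at h₁
    have h₂ : act ((g * γ x)⁻¹ * γ (act g x)) (Quotient.mk r x).out
        = (Quotient.mk r x).out := by
      rw [map_mul, Equiv.Perm.mul_apply, h₁, map_inv, Equiv.Perm.inv_eq_iff_eq, map_mul,
        Equiv.Perm.mul_apply, hγ]
    exact (inv_mul_eq_one.mp (free _ _ h₂)).symm
  refine ⟨Finsupp.linearCombination ℤ fun x => ρ (γ x) (e (Quotient.mk r x).out),
    fun x => ?_, fun g x => ?_⟩
  · have := hp (γ x) _ _ (he (Quotient.mk r x).out)
    rw [linearCombination_single, one_smul]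
    rwa [hγ] at this
  · induction x using Finsupp.induction_linear with
    | zero => simp
    | add x y hx hy => simp only [map_add, hx, hy]
    | single x a => simp [hγ_act, hmk]

namespace FreeRes

/-- A chain map, equivariant along `ψ`, between free resolutions that lifts the identity
of `ℤ`. -/
structure Hom {G G' : Type} [Group G] [Group G'] (ψ : G →* G') (P : FreeRes G)
    (Q : FreeRes G') where
  f : ∀ n, (P.X n →₀ ℤ) →ₗ[ℤ] (Q.X n →₀ ℤ)
  comm : ∀ n x, Q.d n (f (n + 1) x) = f n (P.d n x)
  equivariant : ∀ n g x,
    f n (lmapDomain ℤ ℤ (P.act n g) x) = lmapDomain ℤ ℤ (Q.act n (ψ g)) (f n x)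
  aug_f : ∀ x, aug _ (f 0 x) = aug _ x

section

variable {G G' : Type} [Group G] [Group G']

/-- The linear action of `G` on the terms of a resolution, pulled back along `ψ`. -/
noncomputable def rep (ψ : G →* G') (Q : FreeRes G') (n : ℕ) :
    G →* ((Q.X n →₀ ℤ) →ₗ[ℤ] (Q.X n →₀ ℤ)) where
  toFun g := lmapDomain ℤ ℤ (Q.act n (ψ g))
  map_one' := by
    ext; simp
  map_mul' g h := by
    ext; simp

@[simp]
lemma rep_apply (ψ : G →* G') (Q : FreeRes G') (n : ℕ) (g : G) :
    rep ψ Q n g = lmapDomain ℤ ℤ (Q.act n (ψ g)) := rfl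

lemma lmapDomain_act_single (P : FreeRes G) (n : ℕ) (g : G) (x : P.X n) :
    single (P.act n g x) (1 : ℤ) = lmapDomain ℤ ℤ (P.act n g) (single x 1) := by
  simp

/-- The comparison theorem: existence of lifts. -/
theorem exists_hom (ψ : G →* G') (P : FreeRes G) (Q : FreeRes G') : Nonempty (Hom ψ P Q) := by
  have h0 : ∃ f : (P.X 0 →₀ ℤ) →ₗ[ℤ] (Q.X 0 →₀ ℤ), (∀ x, aug _ (f x) = aug _ x) ∧
      ∀ g x, f (lmapDomain ℤ ℤ (P.act 0 g) x) = lmapDomain ℤ ℤ (Q.act 0 (ψ g)) (f x) := by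
    obtain ⟨f, hf, hfe⟩ := exists_equivariant_linear (P.act 0) (P.act_free 0) (rep ψ Q 0)
      (fun _ e => aug _ e = 1) (fun g x e h => by rw [rep_apply, aug_lmapDomain, h])
      (fun _ => ⟨single Q.nonempty.some 1, by simp⟩)
    refine ⟨f, fun x => ?_, hfe⟩
    have : aug _ ∘ₗ f = aug _ := by
      ext x
      simpa using hf x
    exact LinearMap.congr_fun this x
  have hs : ∀ n (f : (P.X n →₀ ℤ) →ₗ[ℤ] (Q.X n →₀ ℤ)),
      (∀ g x, f (lmapDomain ℤ ℤ (P.act n g) x) = lmapDomain ℤ ℤ (Q.act n (ψ g)) (f x)) →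
      (∀ x, ∃ e, Q.d n e = f (P.d n x)) →
      ∃ f' : (P.X (n + 1) →₀ ℤ) →ₗ[ℤ] (Q.X (n + 1) →₀ ℤ),
        (∀ g x, f' (lmapDomain ℤ ℤ (P.act _ g) x) = lmapDomain ℤ ℤ (Q.act _ (ψ g)) (f' x)) ∧
        ∀ x, Q.d n (f' x) = f (P.d n x) := by
    intro n f hfe hex
    obtain ⟨f', hf', hfe'⟩ := exists_equivariant_linear (P.act (n + 1)) (P.act_free (n + 1))
      (rep ψ Q (n + 1)) (fun x e => Q.d n e = f (P.d n (single x 1)))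
      (fun g x e h => by
        rw [rep_apply, Q.d_act, h, lmapDomain_act_single, P.d_act, hfe])
      (fun x => hex _)
    refine ⟨f', hfe', fun x => ?_⟩
    have : Q.d n ∘ₗ f' = f ∘ₗ P.d n := by
      ext1 x
      ext1
      simpa using hf' x
    exact LinearMap.congr_fun this x
  obtain ⟨f0, ha0, he0⟩ := h0
  let T : ℕ → Type := fun n => { f : (P.X n →₀ ℤ) →ₗ[ℤ] (Q.X n →₀ ℤ) //
    (∀ g x, f (lmapDomain ℤ ℤ (P.act n g) x) = lmapDomain ℤ ℤ (Q.act n (ψ g)) (f x)) ∧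
    ∀ x, ∃ e, Q.d n e = f (P.d n x) }
  have step : ∀ n (t : T n), ∃ t' : T (n + 1), ∀ x, Q.d n (t'.1 x) = t.1 (P.d n x) := by
    rintro n ⟨f, hfe, hex⟩
    obtain ⟨f', hfe', hf'⟩ := hs n f hfe hex
    exact ⟨⟨f', hfe', fun x => Q.exact_succ n _ (by rw [hf', P.d_d, map_zero])⟩, hf'⟩
  choose next hnext using step
  let t : ∀ n, T n := fun n => Nat.rec
    ⟨f0, he0, fun x => Q.exact_zero _ (by rw [ha0, P.aug_d])⟩ (fun n t => next n t) n
  exact ⟨⟨fun n => (t n).1, fun n x => hnext n (t n) x, fun n => (t n).2.1, ha0⟩⟩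

/-- The comparison theorem: uniqueness of lifts up to equivariant homotopy. -/
theorem exists_homotopy {ψ : G →* G'} {P : FreeRes G} {Q : FreeRes G'} (a b : Hom ψ P Q) :
    ∃ s : ∀ n, (P.X n →₀ ℤ) →ₗ[ℤ] (Q.X (n + 1) →₀ ℤ),
      (∀ n g x, s n (lmapDomain ℤ ℤ (P.act n g) x)
        = lmapDomain ℤ ℤ (Q.act (n + 1) (ψ g)) (s n x)) ∧
      ∀ n x, a.f (n + 1) x - b.f (n + 1) x = Q.d (n + 1) (s (n + 1) x) + s n (P.d n x) := by
  have key : ∀ n (c : (P.X n →₀ ℤ) →ₗ[ℤ] (Q.X n →₀ ℤ)),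
      (∀ g x, c (lmapDomain ℤ ℤ (P.act n g) x) = lmapDomain ℤ ℤ (Q.act n (ψ g)) (c x)) →
      (∀ x, ∃ e, Q.d n e = c x) →
      ∃ s : (P.X n →₀ ℤ) →ₗ[ℤ] (Q.X (n + 1) →₀ ℤ),
        (∀ g x, s (lmapDomain ℤ ℤ (P.act n g) x) = lmapDomain ℤ ℤ (Q.act _ (ψ g)) (s x)) ∧
        ∀ x, Q.d n (s x) = c x := by
    intro n c hce hex
    obtain ⟨s, hs, hse⟩ := exists_equivariant_linear (P.act n) (P.act_free n)
      (rep ψ Q (n + 1)) (fun x e => Q.d n e = c (single x 1))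
      (fun g x e h => by
        rw [rep_apply, Q.d_act, h, lmapDomain_act_single, hce])
      (fun x => hex _)
    refine ⟨s, hse, fun x => ?_⟩
    have : Q.d n ∘ₗ s = c := by
      ext1 x
      ext1
      simpa using hs x
    exact LinearMap.congr_fun this x
  let T : ℕ → Type := fun n => { s : (P.X n →₀ ℤ) →ₗ[ℤ] (Q.X (n + 1) →₀ ℤ) //
    (∀ g x, s (lmapDomain ℤ ℤ (P.act n g) x) = lmapDomain ℤ ℤ (Q.act _ (ψ g)) (s x)) ∧
    ∀ x, Q.d n (s (P.d n x)) = a.f n (P.d n x) - b.f n (P.d n x) }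
  have step : ∀ n (t : T n), ∃ t' : T (n + 1), ∀ x,
      a.f (n + 1) x - b.f (n + 1) x = Q.d (n + 1) (t'.1 x) + t.1 (P.d n x) := by
    rintro n ⟨s, hse, hs⟩
    obtain ⟨s', hse', hs'⟩ := key (n + 1) (a.f (n + 1) - b.f (n + 1) - s ∘ₗ P.d n)
      (fun g x => by
        simp only [LinearMap.sub_apply, LinearMap.comp_apply, P.d_act, a.equivariant,
          b.equivariant, hse, map_sub])
      (fun x => Q.exact_succ n _ (by
        simp only [LinearMap.sub_apply, LinearMap.comp_apply, map_sub, a.comm, b.comm, hs,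
          sub_self]))
    refine ⟨⟨s', hse', fun x => ?_⟩, fun x => ?_⟩
    · rw [hs']
      simp [P.d_d]
    · rw [hs']
      simp
  obtain ⟨s0, hse0, hs0⟩ := key 0 (a.f 0 - b.f 0)
    (fun g x => by simp only [LinearMap.sub_apply, a.equivariant, b.equivariant, map_sub])
    (fun x => Q.exact_zero _ (by simp [a.aug_f, b.aug_f]))
  choose next hnext using step
  let t : ∀ n, T n := fun n => Nat.rec
    ⟨s0, hse0, fun x => by rw [hs0]; rfl⟩ (fun n t => next n t) n
  exact ⟨fun n => (t n).1, fun n => (t n).2.1, fun n x => hnext n (t n) x⟩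

/-- Composition of equivariant chain maps. -/
noncomputable def Hom.comp {G'' : Type} [Group G''] {ψ : G →* G'} {χ : G' →* G''}
    {P : FreeRes G} {Q : FreeRes G'} {R : FreeRes G''} (b : Hom χ Q R) (a : Hom ψ P Q) :
    Hom (χ.comp ψ) P R where
  f n := b.f n ∘ₗ a.f n
  comm n x := by simp only [LinearMap.comp_apply, b.comm, a.comm]
  equivariant n g x := by
    simp only [LinearMap.comp_apply, a.equivariant, b.equivariant, MonoidHom.comp_apply]
  aug_f x := by simp only [LinearMap.comp_apply, b.aug_f, a.aug_f]

/-- The identity chain map. -/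
noncomputable def Hom.id (P : FreeRes G) : Hom (MonoidHom.id G) P P where
  f _ := LinearMap.id
  comm _ _ := rfl
  equivariant _ _ _ := rfl
  aug_f _ := rfl

/-- Restriction of a free resolution along an injective homomorphism. -/
abbrev res (ψ : G →* G') (hψ : Function.Injective ψ) (Q : FreeRes G') : FreeRes G where
  X := Q.X
  act n := (Q.act n).comp ψ
  act_free n g x h := hψ (by rw [map_one]; exact Q.act_free n _ x h)
  nonempty := Q.nonempty
  d := Q.d
  d_act n g x := Q.d_act n (ψ g) x
  d_d := Q.d_d
  aug_d := Q.aug_d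
  exact_zero := Q.exact_zero
  exact_succ := Q.exact_succ

end

end FreeRes

section Bar

variable (G : Type) [Group G]

/-- The differential of the bar resolution. -/
noncomputable def barD (n : ℕ) :
    ((G × (Fin (n + 1) → G)) →₀ ℤ) →ₗ[ℤ] ((G × (Fin n → G)) →₀ ℤ) :=
  Finsupp.linearCombination ℤ fun x =>
    single (x.1 * x.2 0, fun i => x.2 i.succ) 1
      + ∑ j : Fin (n + 1),
          ((-1 : ℤ) ^ ((j : ℕ) + 1)) • single (x.1, Fin.contractNth j (· * ·) x.2) 1

/-- Left translation on the first factor of `G × B`. -/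
def leftAct (B : Type) : G →* Equiv.Perm (G × B) where
  toFun g := (Equiv.mulLeft g).prodCongr (Equiv.refl _)
  map_one' := by ext <;> simp
  map_mul' g h := by ext <;> simp [mul_assoc]

/-- The contracting homotopy of the bar resolution. -/
noncomputable def barH (n : ℕ) :
    ((G × (Fin n → G)) →₀ ℤ) →ₗ[ℤ] ((G × (Fin (n + 1) → G)) →₀ ℤ) :=
  lmapDomain ℤ ℤ fun x => (1, Fin.cons x.1 x.2)

variable {G}

@[simp]
lemma leftAct_apply (B : Type) (g : G) (x : G × B) : leftAct G B g x = (g * x.1, x.2) :=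
  rfl

lemma barD_single (n : ℕ) (x : G × (Fin (n + 1) → G)) :
    barD G n (single x 1) = single (x.1 * x.2 0, fun i => x.2 i.succ) 1
      + ∑ j : Fin (n + 1),
          ((-1 : ℤ) ^ ((j : ℕ) + 1)) • single (x.1, Fin.contractNth j (· * ·) x.2) 1 := by
  simp [barD]

lemma barH_single (n : ℕ) (x : G × (Fin n → G)) :
    barH G n (single x 1) = single (1, Fin.cons x.1 x.2) 1 := by
  simp [barH]

lemma contractNth_zero_cons {n : ℕ} (g : G) (b : Fin (n + 1) → G) :
    Fin.contractNth 0 (· * ·) (Fin.cons g b : Fin (n + 2) → G)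
      = Fin.cons (g * b 0) fun i => b i.succ := by
  funext i
  refine Fin.cases ?_ (fun i => ?_) i
  · rw [Fin.contractNth_apply_of_eq _ _ _ _ (by simp)]
    simp
  · rw [Fin.contractNth_apply_of_gt _ _ _ _ (by simp)]
    simp

lemma contractNth_succ_cons {n : ℕ} (j : Fin (n + 1)) (g : G) (b : Fin (n + 1) → G) :
    Fin.contractNth j.succ (· * ·) (Fin.cons g b : Fin (n + 2) → G)
      = Fin.cons g (Fin.contractNth j (· * ·) b) := by
  funext i
  refine Fin.cases ?_ (fun i => ?_) i
  · rw [Fin.contractNth_apply_of_lt _ _ _ _ (by simp)]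
    simp
  · rcases lt_trichotomy (i : ℕ) (j : ℕ) with h | h | h
    · rw [Fin.contractNth_apply_of_lt _ _ _ _ (by simpa using h), Fin.cons_succ,
        Fin.contractNth_apply_of_lt _ _ _ _ h, ← Fin.succ_castSucc, Fin.cons_succ]
    · rw [Fin.contractNth_apply_of_eq _ _ _ _ (by simpa using h), Fin.cons_succ, Fin.cons_succ,
        Fin.contractNth_apply_of_eq _ _ _ _ h, ← Fin.succ_castSucc, Fin.cons_succ]
    · rw [Fin.contractNth_apply_of_gt _ _ _ _ (by simpa using h), Fin.cons_succ, Fin.cons_succ,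
        Fin.contractNth_apply_of_gt _ _ _ _ h]

lemma barD_barH_zero (x : (G × (Fin 0 → G)) →₀ ℤ) :
    barD G 0 (barH G 0 x) = x - aug _ x • single (1, Fin.elim0) 1 := by
  have : barD G 0 ∘ₗ barH G 0 = LinearMap.id
      - (LinearMap.toSpanSingleton ℤ _ (single (1, Fin.elim0) 1)) ∘ₗ aug (G × (Fin 0 → G)) := by
    ext1 x
    ext1
    have h : ∀ b : Fin 0 → G, b = Fin.elim0 := fun b => Subsingleton.elim _ _
    simp only [LinearMap.comp_apply, lsingle_apply, barH_single, barD_single,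
      LinearMap.sub_apply, aug_single]
    rw [Fin.sum_univ_one, h (Fin.contractNth _ _ _), h fun i => _]
    have hx : (x.1, Fin.elim0) = x := Prod.ext rfl (h _).symm
    simp [hx, sub_eq_add_neg]
  exact LinearMap.congr_fun this x

lemma barD_barH_succ (n : ℕ) (x : (G × (Fin (n + 1) → G)) →₀ ℤ) :
    barD G (n + 1) (barH G (n + 1) x) = x - barH G n (barD G n x) := by
  have : barD G (n + 1) ∘ₗ barH G (n + 1) = LinearMap.id - barH G n ∘ₗ barD G n := by
    ext1 x
    ext1
    simp only [LinearMap.comp_apply, lsingle_apply, barH_single, barD_single,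
      LinearMap.sub_apply, map_add, map_sum, map_smul, LinearMap.id_apply]
    rw [Fin.sum_univ_succ]
    simp only [contractNth_zero_cons, contractNth_succ_cons, Fin.cons_zero, Fin.cons_succ,
      one_mul, Fin.val_zero, Fin.val_succ, pow_succ (-1 : ℤ) (_ + 1), mul_neg, mul_one,
      neg_smul, Finset.sum_neg_distrib]
    simp only [zero_add, pow_one, neg_smul, one_smul]
    abel
  exact LinearMap.congr_fun this x

lemma barD_act (n : ℕ) (g : G) (x : (G × (Fin (n + 1) → G)) →₀ ℤ) :
    barD G n (lmapDomain ℤ ℤ (leftAct G (Fin (n + 1) → G) g) x)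
      = lmapDomain ℤ ℤ (leftAct G (Fin n → G) g) (barD G n x) := by
  have : barD G n ∘ₗ lmapDomain ℤ ℤ (leftAct G (Fin (n + 1) → G) g)
      = lmapDomain ℤ ℤ (leftAct G (Fin n → G) g) ∘ₗ barD G n := by
    ext1 x
    ext1
    simp [barD_single, mapDomain_single, mapDomain_add, mapDomain_finsetSum, mapDomain_smul,
      mul_assoc, -smul_single]
  exact LinearMap.congr_fun this x

lemma aug_barD (x : (G × (Fin 1 → G)) →₀ ℤ) : aug _ (barD G 0 x) = 0 := by
  have : aug _ ∘ₗ barD G 0 = 0 := by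
    ext1 x
    ext1
    simp [barD_single]
  exact LinearMap.congr_fun this x

/-- Basis elements of the bar resolution are translates of values of the contracting
homotopy, so equivariant maps can be compared on those. -/
lemma bar_hom_ext_zero {n : ℕ} {M : Type} [AddCommGroup M] [Module ℤ M]
    (f : ((G × (Fin (n + 1) → G)) →₀ ℤ) →ₗ[ℤ] M)
    (hf : ∀ g x, f x = 0 → f (lmapDomain ℤ ℤ (leftAct G (Fin (n + 1) → G) g) x) = 0)
    (h : ∀ y, f (barH G n y) = 0) (x) : f x = 0 := by
  have : f = 0 := by
    ext1 x
    ext1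
    have := hf x.1 _ (h (single (x.2 0, fun i => x.2 i.succ) 1))
    rw [barH_single, lmapDomain_apply, mapDomain_single, leftAct_apply, mul_one] at this
    have hc : (Fin.cons (x.2 0) fun i => x.2 i.succ : Fin (n + 1) → G) = x.2 :=
      Fin.cons_self_tail x.2
    simpa [hc] using this
  rw [this, LinearMap.zero_apply]

lemma barD_barD (n : ℕ) (x : (G × (Fin (n + 2) → G)) →₀ ℤ) :
    barD G n (barD G (n + 1) x) = 0 := by
  induction n with
  | zero =>
    refine bar_hom_ext_zero (barD G 0 ∘ₗ barD G 1) (fun g x hx => ?_) (fun y => ?_) x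
    · simp only [LinearMap.comp_apply] at hx ⊢
      rw [barD_act, barD_act, hx, map_zero]
    · simp only [LinearMap.comp_apply]
      rw [barD_barH_succ, map_sub, barD_barH_zero, aug_barD]
      simp
  | succ n ih =>
    refine bar_hom_ext_zero (barD G (n + 1) ∘ₗ barD G (n + 2)) (fun g x hx => ?_)
      (fun y => ?_) x
    · simp only [LinearMap.comp_apply] at hx ⊢
      rw [barD_act, barD_act, hx, map_zero]
    · simp only [LinearMap.comp_apply]
      rw [barD_barH_succ, map_sub, barD_barH_succ, ih]
      simp

variable (G)

/-- The bar resolution. -/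
noncomputable abbrev bar : FreeRes G where
  X n := G × (Fin n → G)
  act n := leftAct G (Fin n → G)
  act_free n g x h := by simpa using congrArg Prod.fst h
  nonempty := ⟨(1, Fin.elim0)⟩
  d := barD G
  d_act := barD_act
  d_d := barD_barD
  aug_d := aug_barD
  exact_zero x hx := ⟨barH G 0 x, by rw [barD_barH_zero, hx]; simp⟩
  exact_succ n x hx := ⟨barH G (n + 1) x, by rw [barD_barH_succ, hx]; simp⟩

variable {G}

/-- The map of bar resolutions induced by a group homomorphism. -/
noncomputable def barMap {G' : Type} [Group G'] (ψ : G →* G') :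
    FreeRes.Hom ψ (bar G) (bar G') where
  f n := lmapDomain ℤ ℤ fun x => (ψ x.1, ψ ∘ x.2)
  comm n x := by
    have : barD G' n ∘ₗ lmapDomain ℤ ℤ (fun x => (ψ x.1, ψ ∘ x.2))
        = lmapDomain ℤ ℤ (fun x => (ψ x.1, ψ ∘ x.2)) ∘ₗ barD G n := by
      ext1 x
      ext1
      simp only [LinearMap.comp_apply, lsingle_apply, lmapDomain_apply, mapDomain_single,
        barD_single, mapDomain_add, mapDomain_finsetSum, mapDomain_smul, comp_contractNth,
        map_mul, Function.comp_apply]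
      rfl
    exact LinearMap.congr_fun this x
  equivariant n g x := by
    simp only [lmapDomain_apply, ← mapDomain_comp]
    congr 1
    ext x <;> simp
  aug_f := aug_lmapDomain _

/-- Left translation by `s`, as a map of bar resolutions that is equivariant along conjugation
by `s`. -/
noncomputable def barTranslate (s : G) :
    FreeRes.Hom (MulAut.conj s).toMonoidHom (bar G) (bar G) where
  f n := lmapDomain ℤ ℤ (leftAct G (Fin n → G) s)
  comm n := barD_act n s
  equivariant n g x := by
    simp only [lmapDomain_apply, ← mapDomain_comp]
    congr 1
    funext x
    refine Prod.ext ?_ rfl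
    change s * (g * x.1) = s * g * s⁻¹ * (s * x.1)
    group
  aug_f := aug_lmapDomain _

end Bar

section Coinvariants

variable {G G' B B' : Type} [Group G] [Group G']

/-- The passage to coinvariants `ℤ[G × B] → ℤ[B]`. -/
noncomputable def proj (G B : Type) : ((G × B) →₀ ℤ) →ₗ[ℤ] (B →₀ ℤ) :=
  lmapDomain ℤ ℤ Prod.snd

/-- The section `b ↦ (1, b)` of the passage to coinvariants. -/
noncomputable def sec (G B : Type) [Group G] : (B →₀ ℤ) →ₗ[ℤ] ((G × B) →₀ ℤ) :=
  lmapDomain ℤ ℤ fun b => (1, b)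

lemma proj_leftAct (g : G) (x : (G × B) →₀ ℤ) :
    proj G B (lmapDomain ℤ ℤ (leftAct G B g) x) = proj G B x := by
  simp only [proj, lmapDomain_apply, ← mapDomain_comp]
  rfl

@[simp]
lemma proj_sec (x : B →₀ ℤ) : proj G B (sec G B x) = x := by
  simp only [proj, sec, lmapDomain_apply, ← mapDomain_comp]
  exact mapDomain_id

lemma apply_sec_proj {M : Type} [AddCommGroup M] [Module ℤ M] (f : ((G × B) →₀ ℤ) →ₗ[ℤ] M)
    (hf : ∀ g x, f (lmapDomain ℤ ℤ (leftAct G B g) x) = f x) (x : (G × B) →₀ ℤ) :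
    f (sec G B (proj G B x)) = f x := by
  have : f ∘ₗ sec G B ∘ₗ proj G B = f := by
    ext1 x
    ext1
    have := hf x.1 (single (1, x.2) 1)
    rw [lmapDomain_apply, mapDomain_single, leftAct_apply, mul_one] at this
    simpa [sec, proj] using this.symm
  exact LinearMap.congr_fun this x

/-- The map induced on coinvariants. -/
noncomputable def desc (f : ((G × B) →₀ ℤ) →ₗ[ℤ] ((G' × B') →₀ ℤ)) :
    (B →₀ ℤ) →ₗ[ℤ] (B' →₀ ℤ) :=
  proj G' B' ∘ₗ f ∘ₗ sec G B

lemma desc_proj (ψ : G →* G') (f : ((G × B) →₀ ℤ) →ₗ[ℤ] ((G' × B') →₀ ℤ))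
    (hf : ∀ g x, f (lmapDomain ℤ ℤ (leftAct G B g) x)
      = lmapDomain ℤ ℤ (leftAct G' B' (ψ g)) (f x)) (x : (G × B) →₀ ℤ) :
    desc f (proj G B x) = proj G' B' (f x) :=
  apply_sec_proj (proj G' B' ∘ₗ f) (fun g x => by
    simp only [LinearMap.comp_apply, hf, proj_leftAct]) x

lemma desc_comp {G'' B'' : Type} [Group G''] (ψ : G' →* G'')
    (f : ((G' × B') →₀ ℤ) →ₗ[ℤ] ((G'' × B'') →₀ ℤ))
    (hf : ∀ g x, f (lmapDomain ℤ ℤ (leftAct G' B' g) x)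
      = lmapDomain ℤ ℤ (leftAct G'' B'' (ψ g)) (f x))
    (e : ((G × B) →₀ ℤ) →ₗ[ℤ] ((G' × B') →₀ ℤ)) :
    desc (f ∘ₗ e) = desc f ∘ₗ desc e :=
  LinearMap.ext fun x => (desc_proj ψ f hf (e (sec G B x))).symm

lemma desc_add {G' : Type} (e f : ((G × B) →₀ ℤ) →ₗ[ℤ] ((G' × B') →₀ ℤ)) :
    desc (e + f) = desc e + desc f := by
  rw [desc, LinearMap.add_comp, LinearMap.comp_add]
  rfl

lemma desc_sub {G' : Type} (e f : ((G × B) →₀ ℤ) →ₗ[ℤ] ((G' × B') →₀ ℤ)) :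
    desc (e - f) = desc e - desc f := by
  rw [desc, LinearMap.sub_comp, LinearMap.comp_sub]
  rfl

@[simp]
lemma desc_id : desc (LinearMap.id : ((G × B) →₀ ℤ) →ₗ[ℤ] _) = LinearMap.id :=
  LinearMap.ext fun x => proj_sec x

/-- Equivariant homotopies descend to coinvariants. -/
lemma desc_homotopy {B₀ B₂ : Type} (ψ : G →* G')
    {e f : ((G × B) →₀ ℤ) →ₗ[ℤ] ((G' × B') →₀ ℤ)}
    {dP : ((G × B) →₀ ℤ) →ₗ[ℤ] ((G × B₀) →₀ ℤ)}
    {dQ : ((G' × B₂) →₀ ℤ) →ₗ[ℤ] ((G' × B') →₀ ℤ)}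
    {s : ((G × B) →₀ ℤ) →ₗ[ℤ] ((G' × B₂) →₀ ℤ)}
    {s₀ : ((G × B₀) →₀ ℤ) →ₗ[ℤ] ((G' × B') →₀ ℤ)}
    (hdQ : ∀ g x, dQ (lmapDomain ℤ ℤ (leftAct G' B₂ g) x)
      = lmapDomain ℤ ℤ (leftAct G' B' g) (dQ x))
    (hs₀ : ∀ g x, s₀ (lmapDomain ℤ ℤ (leftAct G B₀ g) x)
      = lmapDomain ℤ ℤ (leftAct G' B' (ψ g)) (s₀ x))
    (h : ∀ x, e x - f x = dQ (s x) + s₀ (dP x)) :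
    desc e - desc f = desc dQ ∘ₗ desc s + desc s₀ ∘ₗ desc dP := by
  rw [← desc_comp (MonoidHom.id _) dQ hdQ, ← desc_comp ψ s₀ hs₀, ← desc_sub, ← desc_add]
  exact congrArg desc (LinearMap.ext h)

lemma desc_barD (n : ℕ) : desc (barD G n) = d ℤ G ℤ n := by
  ext1 x
  ext1
  simp [desc, sec, proj, barD_single, d, mapDomain_single, mapDomain_add, mapDomain_finsetSum,
    mapDomain_smul, -smul_single]

lemma desc_barMap (ψ : G →* G') (n : ℕ) : desc ((barMap ψ).f n) = chainsMap ℤ ℤ ψ n := by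
  ext1 x
  ext1
  simp [desc, sec, proj, barMap, chainsMap]

lemma desc_barTranslate (s : G) (n : ℕ) : desc ((barTranslate s).f n) = LinearMap.id := by
  ext1 x
  ext1
  simp [desc, sec, proj, barTranslate]

end Coinvariants

section Periodic

/-- The cyclic group of order three. -/
abbrev C3 : Type := Multiplicative (ZMod 3)

/-- The generator of the cyclic group of order three. -/
def gen : C3 := Multiplicative.ofAdd 1

/-- Multiplication by the generator minus one on `ℤ[C3]`. -/
noncomputable def genSubOne : ((C3 × Unit) →₀ ℤ) →ₗ[ℤ] ((C3 × Unit) →₀ ℤ) :=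
  lmapDomain ℤ ℤ (fun x => (x.1 * gen, x.2)) - LinearMap.id

/-- The norm element of `ℤ[C3]`. -/
noncomputable def normElt : (C3 × Unit) →₀ ℤ :=
  single (1, ()) 1 + single (gen, ()) 1 + single (gen * gen, ()) 1

/-- Multiplication by the norm element on `ℤ[C3]`. -/
noncomputable def normMap : ((C3 × Unit) →₀ ℤ) →ₗ[ℤ] ((C3 × Unit) →₀ ℤ) :=
  (LinearMap.toSpanSingleton ℤ _ normElt) ∘ₗ aug _

lemma normMap_apply (x : (C3 × Unit) →₀ ℤ) : normMap x = aug _ x • normElt := rfl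

lemma genSubOne_single (x : C3 × Unit) (a : ℤ) :
    genSubOne (single x a) = single (x.1 * gen, x.2) a - single x a := by
  simp [genSubOne]

lemma aug_normElt : aug _ normElt = 3 := by
  simp [normElt]

lemma c3_cases (c : C3) : c = 1 ∨ c = gen ∨ c = gen * gen := by
  revert c; decide

lemma c3_decomp (x : (C3 × Unit) →₀ ℤ) :
    x = single (1, ()) (x (1, ())) + single (gen, ()) (x (gen, ()))
      + single (gen * gen, ()) (x (gen * gen, ())) := by
  have h₁ : (1 : C3) ≠ gen := by decide
  have h₂ : (1 : C3) ≠ gen * gen := by decide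
  have h₃ : gen ≠ gen * gen := by decide
  ext ⟨c, u⟩
  rcases c3_cases c with rfl | rfl | rfl <;>
    simp [h₁, h₂, h₃, h₁.symm, h₂.symm, h₃.symm, -mul_eq_left, -left_eq_mul]

lemma genSubOne_normElt : genSubOne normElt = 0 := by
  have h : gen * gen * gen = 1 := by decide
  simp only [normElt, map_add, genSubOne_single, one_mul, h]
  abel

lemma aug_genSubOne (x : (C3 × Unit) →₀ ℤ) : aug _ (genSubOne x) = 0 := by
  simp only [genSubOne, LinearMap.sub_apply, map_sub, aug_lmapDomain, LinearMap.id_apply,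
    sub_self]

lemma genSubOne_normMap (x : (C3 × Unit) →₀ ℤ) : genSubOne (normMap x) = 0 := by
  rw [normMap_apply, map_smul, genSubOne_normElt, smul_zero]

lemma normMap_genSubOne (x : (C3 × Unit) →₀ ℤ) : normMap (genSubOne x) = 0 := by
  rw [normMap_apply, aug_genSubOne, zero_smul]

lemma exists_genSubOne_eq (x : (C3 × Unit) →₀ ℤ) (hx : aug _ x = 0) :
    ∃ y, genSubOne y = x := by
  have h : gen * gen * gen = 1 := by decide
  refine ⟨single (gen, ()) (-x (gen, ()))
    + single (gen * gen, ()) (-x (gen, ()) - x (gen * gen, ())), ?_⟩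
  have hx' : x (1, ()) = -x (gen, ()) - x (gen * gen, ()) := by
    rw [c3_decomp x] at hx
    simp only [map_add, aug_single] at hx
    linarith
  conv_rhs => rw [c3_decomp x, hx']
  simp only [map_add, single_sub, single_neg, map_neg, map_sub, genSubOne_single, h]
  abel

lemma exists_normMap_eq (x : (C3 × Unit) →₀ ℤ) (hx : genSubOne x = 0) :
    ∃ y, normMap y = x := by
  have h : gen * gen * gen = 1 := by decide
  have h₁ : (1 : C3) ≠ gen := by decide
  have h₂ : (1 : C3) ≠ gen * gen := by decide
  have h₃ : gen ≠ gen * gen := by decide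
  rw [c3_decomp x] at hx
  simp only [map_add, genSubOne_single, h, one_mul] at hx
  have e₁ := DFunLike.congr_fun hx (gen, ())
  have e₂ := DFunLike.congr_fun hx (gen * gen, ())
  simp [h₃, h₁.symm, h₂.symm, h₃.symm, -mul_eq_left, -left_eq_mul] at e₁ e₂
  refine ⟨single (1, ()) (x (1, ())), ?_⟩
  have e₁' : x (gen, ()) = x (1, ()) := by linarith
  have e₂' : x (gen * gen, ()) = x (1, ()) := by linarith
  conv_rhs => rw [c3_decomp x, e₁', e₂']
  simp [normMap_apply, normElt]

lemma genSubOne_act (g : C3) (x : (C3 × Unit) →₀ ℤ) :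
    genSubOne (lmapDomain ℤ ℤ (leftAct C3 Unit g) x)
      = lmapDomain ℤ ℤ (leftAct C3 Unit g) (genSubOne x) := by
  simp only [genSubOne, LinearMap.sub_apply, map_sub, LinearMap.id_apply, lmapDomain_apply,
    ← mapDomain_comp]
  congr 2
  funext x
  exact Prod.ext (mul_assoc _ _ _) rfl

lemma normElt_act (g : C3) : lmapDomain ℤ ℤ (leftAct C3 Unit g) normElt = normElt := by
  have h : gen * gen * gen = 1 := by decide
  have h' : gen * (gen * gen) = 1 := by decide
  rcases c3_cases g with rfl | rfl | rfl <;>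
    simp only [normElt, map_add, lmapDomain_apply, mapDomain_single, leftAct_apply, one_mul,
      mul_one, mul_assoc, h'] <;> abel

lemma normMap_act (g : C3) (x : (C3 × Unit) →₀ ℤ) :
    normMap (lmapDomain ℤ ℤ (leftAct C3 Unit g) x)
      = lmapDomain ℤ ℤ (leftAct C3 Unit g) (normMap x) := by
  rw [normMap_apply, normMap_apply, map_smul, normElt_act, aug_lmapDomain]

/-- The differential of the two-periodic resolution of the cyclic group of order three. -/
noncomputable def perD (n : ℕ) : ((C3 × Unit) →₀ ℤ) →ₗ[ℤ] ((C3 × Unit) →₀ ℤ) :=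
  if Even n then genSubOne else normMap

lemma perD_even {n : ℕ} (h : Even n) : perD n = genSubOne := if_pos h

lemma perD_odd {n : ℕ} (h : ¬ Even n) : perD n = normMap := if_neg h

/-- The two-periodic resolution of the cyclic group of order three. -/
noncomputable abbrev per : FreeRes C3 where
  X _ := C3 × Unit
  act _ := leftAct C3 Unit
  act_free n g x h := by simpa using congrArg Prod.fst h
  nonempty := ⟨(1, ())⟩
  d := perD
  d_act n g x := by
    by_cases h : Even n
    · rw [perD_even h, genSubOne_act]
    · rw [perD_odd h, normMap_act]
  d_d n x := by
    by_cases h : Even n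
    · rw [perD_even h, perD_odd (by simpa [Nat.even_add_one] using h), genSubOne_normMap]
    · rw [perD_odd h, perD_even (Nat.even_add_one.mpr h), normMap_genSubOne]
  aug_d x := by rw [perD_even (by simp), aug_genSubOne]
  exact_zero x hx := by
    rw [perD_even (by simp)]
    exact exists_genSubOne_eq x hx
  exact_succ n x hx := by
    by_cases h : Even n
    · rw [perD_even h] at hx
      rw [perD_odd (by simpa [Nat.even_add_one] using h)]
      exact exists_normMap_eq x hx
    · rw [perD_odd h, normMap_apply] at hx
      rw [perD_even (Nat.even_add_one.mpr h)]
      refine exists_genSubOne_eq x ?_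
      have := congrArg (aug _) hx
      rw [map_smul, aug_normElt, map_zero] at this
      simpa using this

/-- Inversion on `C3`. -/
def inv3 : C3 →* C3 := invMonoidHom

/-- The sign by which inversion acts in degree `n`. -/
def sgn (n : ℕ) : ℤ := (-1) ^ ((n + 1) / 2)

/-- The chain map of the periodic resolution covering inversion. -/
noncomputable def perInv : FreeRes.Hom inv3 per per where
  f n := sgn n • lmapDomain ℤ ℤ fun x => (x.1⁻¹ * if Even n then 1 else gen⁻¹, x.2)
  comm n x := by
    by_cases h : Even n
    · have h' : ¬ Even (n + 1) := by simpa [Nat.even_add_one] using h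
      have hs : sgn (n + 1) = - sgn n := by
        obtain ⟨k, rfl⟩ := h
        rw [sgn, sgn, show (k + k + 1 + 1) / 2 = k + 1 by lia, show (k + k + 1) / 2 = k by lia,
          pow_succ]
        simp
      simp only [perD_even h, h, h', if_true, if_false, hs]
      have : genSubOne ∘ₗ (-sgn n • lmapDomain ℤ ℤ fun x : C3 × Unit => (x.1⁻¹ * gen⁻¹, x.2))
          = (sgn n • lmapDomain ℤ ℤ fun x : C3 × Unit => (x.1⁻¹ * 1, x.2)) ∘ₗ genSubOne := by
        ext1 x
        ext1
        simp only [LinearMap.comp_apply, LinearMap.smul_apply, lsingle_apply, lmapDomain_apply,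
          mapDomain_single, mapDomain_sub, map_smul, genSubOne_single, mul_one,
          inv_mul_cancel_right, mul_inv, neg_smul, smul_sub, LinearMap.neg_apply, map_neg]
        abel
      exact LinearMap.congr_fun this x
    · have h' : Even (n + 1) := Nat.even_add_one.mpr h
      have hs : sgn (n + 1) = sgn n := by
        obtain ⟨k, rfl⟩ := Nat.not_even_iff_odd.mp h
        rw [sgn, sgn, show (2 * k + 1 + 1 + 1) / 2 = (2 * k + 1 + 1) / 2 by lia]
      have hN : lmapDomain ℤ ℤ (fun x : C3 × Unit => (x.1⁻¹ * gen⁻¹, x.2)) normElt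
          = normElt := by
        have h₁ : gen⁻¹ = gen * gen := by decide
        have h₂ : gen⁻¹ * gen⁻¹ = gen := by decide
        have h₃ : (gen * gen)⁻¹ * gen⁻¹ = 1 := by decide
        simp only [normElt, map_add, lmapDomain_apply, mapDomain_single, h₂, h₃, inv_one,
          one_mul]
        rw [h₁]
        abel
      simp only [perD_odd h, h, h', if_true, if_false, hs, normMap_apply,
        LinearMap.smul_apply, map_smul, aug_lmapDomain, hN]
      rw [smul_comm]
  equivariant n g x := by
    simp only [LinearMap.smul_apply, map_smul, lmapDomain_apply, ← mapDomain_comp]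
    congr 2
    funext x
    refine Prod.ext ?_ rfl
    exact (congrArg (· * _) (mul_inv g x.1)).trans (mul_assoc _ _ _)
  aug_f x := by
    simp [sgn, aug_lmapDomain, -lmapDomain_apply]

/-- The differential of the coinvariants of the periodic resolution. -/
noncomputable def perCoinvD (n : ℕ) : ℤ := if Even n then 0 else 3

lemma desc_perD (n : ℕ) : desc (perD n) = perCoinvD n • LinearMap.id := by
  ext1 x
  ext1
  by_cases h : Even n
  · simp [desc, sec, proj, perD_even h, genSubOne_single, perCoinvD, h, mapDomain_sub]
  · simp only [desc, sec, proj, perD_odd h, perCoinvD, h, LinearMap.comp_apply, lsingle_apply,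
      lmapDomain_apply, mapDomain_single, normMap_apply, aug_single, one_smul, normElt,
      mapDomain_add, if_false, LinearMap.smul_apply, LinearMap.id_apply, ← single_add]
    simp

lemma desc_perInv (n : ℕ) : desc (perInv.f n) = sgn n • LinearMap.id := by
  ext1 x
  ext1
  simp [desc, sec, proj, perInv, -smul_single]

end Periodic

section Coefficients

variable (A : Type) [AddCommGroup A] [Module ℤ A] {X Y Z : Type}

open Classical in
/-- Extension of a map of free abelian groups to coefficients in `A`. -/
noncomputable def coeffs (f : (X →₀ ℤ) →ₗ[ℤ] (Y →₀ ℤ)) : (X →₀ A) →ₗ[ℤ] (Y →₀ A) :=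
  (TensorProduct.finsuppScalarLeft ℤ A Y).toLinearMap ∘ₗ f.rTensor A ∘ₗ
    (TensorProduct.finsuppScalarLeft ℤ A X).symm.toLinearMap

open Classical in
lemma coeffs_single (f : (X →₀ ℤ) →ₗ[ℤ] (Y →₀ ℤ)) (x : X) (a : A) :
    coeffs A f (single x a)
      = mapRange.linearMap (LinearMap.toSpanSingleton ℤ A a) (f (single x 1)) := by
  ext y
  simp [coeffs, TensorProduct.finsuppScalarLeft_symm_apply_single,
    TensorProduct.finsuppScalarLeft_apply_tmul_apply]

open Classical in
lemma coeffs_comp (f : (Y →₀ ℤ) →ₗ[ℤ] (Z →₀ ℤ)) (g : (X →₀ ℤ) →ₗ[ℤ] (Y →₀ ℤ)) :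
    coeffs A (f ∘ₗ g) = coeffs A f ∘ₗ coeffs A g := by
  refine LinearMap.ext fun x => ?_
  simp [coeffs, LinearMap.rTensor_comp]

open Classical in
lemma coeffs_add (f g : (X →₀ ℤ) →ₗ[ℤ] (Y →₀ ℤ)) :
    coeffs A (f + g) = coeffs A f + coeffs A g := by
  rw [coeffs, LinearMap.rTensor_add, LinearMap.add_comp, LinearMap.comp_add]
  rfl

open Classical in
lemma coeffs_sub (f g : (X →₀ ℤ) →ₗ[ℤ] (Y →₀ ℤ)) :
    coeffs A (f - g) = coeffs A f - coeffs A g := by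
  rw [coeffs, LinearMap.rTensor_sub, LinearMap.sub_comp, LinearMap.comp_sub]
  rfl

lemma coeffs_smul (m : ℤ) (f : (X →₀ ℤ) →ₗ[ℤ] (Y →₀ ℤ)) :
    coeffs A (m • f) = m • coeffs A f :=
  map_zsmul (AddMonoidHom.mk' (coeffs A) (coeffs_add A)) m f

open Classical in
lemma coeffs_id : coeffs A (LinearMap.id : (X →₀ ℤ) →ₗ[ℤ] _) = LinearMap.id := by
  ext1 x
  simp [coeffs]

lemma mapRange_toSpanSingleton_single_one (x : X) (a : A) :
    mapRange.linearMap (LinearMap.toSpanSingleton ℤ A a) (single x 1) = single x a := by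
  rw [mapRange.linearMap_apply, mapRange_single]
  exact congrArg (single x) (LinearMap.toSpanSingleton_apply_one ℤ A a)

lemma coeffs_d (G : Type) [Group G] (n : ℕ) : coeffs A (d ℤ G ℤ n) = d ℤ G A n := by
  apply Finsupp.lhom_ext
  intro g a
  rw [coeffs_single]
  simp only [d, lsum_single, LinearMap.add_apply, LinearMap.sum_apply, LinearMap.smul_apply,
    lsingle_apply, map_add, map_sum, LinearMap.map_smul, mapRange_toSpanSingleton_single_one]

lemma coeffs_chainsMap {G G' : Type} [Group G] [Group G'] (ψ : G →* G') (n : ℕ) :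
    coeffs A (chainsMap ℤ ℤ ψ n) = chainsMap ℤ A ψ n := by
  apply Finsupp.lhom_ext
  intro g a
  rw [coeffs_single]
  simp only [chainsMap, lmapDomain_apply, mapDomain_single, mapRange_toSpanSingleton_single_one]

end Coefficients

section Comparison

variable {G : Type} [Group G]

/-- Chain maps and homotopies relating the bar complexes of `C3` and of an overgroup `G` to the
coinvariants of the periodic resolution of `C3`. The element `s` is meant to be an involution
of `G` that inverts the image of `φ`, which has index two. -/
structure Comparison (φ : C3 →* G) (s : G) (A : Type) [AddCommGroup A] [Module ℤ A] where
  toPer : ∀ n, chains C3 A n →ₗ[ℤ] (Unit →₀ A)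
  toBar : ∀ n, (Unit →₀ A) →ₗ[ℤ] chains C3 A n
  transfer : ∀ n, chains G A n →ₗ[ℤ] (Unit →₀ A)
  htpyBar : ∀ n, chains C3 A n →ₗ[ℤ] chains C3 A (n + 1)
  htpyInv : ∀ n, (Unit →₀ A) →ₗ[ℤ] chains C3 A (n + 1)
  htpyConj : ∀ n, chains G A n →ₗ[ℤ] chains G A (n + 1)
  htpyTransfer : ℕ → (Unit →₀ A) →ₗ[ℤ] (Unit →₀ A)
  toPer_comm : ∀ n, perCoinvD n • toPer (n + 1) = toPer n ∘ₗ d ℤ C3 A n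
  toBar_comm : ∀ n, d ℤ C3 A n ∘ₗ toBar (n + 1) = perCoinvD n • toBar n
  transfer_comm : ∀ n, perCoinvD n • transfer (n + 1) = transfer n ∘ₗ d ℤ G A n
  toBar_toPer : ∀ n, toBar (n + 1) ∘ₗ toPer (n + 1) - LinearMap.id
    = d ℤ C3 A (n + 1) ∘ₗ htpyBar (n + 1) + htpyBar n ∘ₗ d ℤ C3 A n
  inv_toBar : ∀ n, chainsMap ℤ A inv3 (n + 1) ∘ₗ toBar (n + 1) - sgn (n + 1) • toBar (n + 1)
    = d ℤ C3 A (n + 1) ∘ₗ htpyInv (n + 1) + perCoinvD n • htpyInv n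
  conj_sub : ∀ n, chainsMap ℤ A (MulAut.conj s).toMonoidHom (n + 1) - LinearMap.id
    = d ℤ G A (n + 1) ∘ₗ htpyConj (n + 1) + htpyConj n ∘ₗ d ℤ G A n
  transfer_toBar : ∀ n,
    transfer (n + 1) ∘ₗ chainsMap ℤ A φ (n + 1) ∘ₗ toBar (n + 1)
        - (1 + sgn (n + 1)) • LinearMap.id
      = perCoinvD (n + 1) • htpyTransfer (n + 1) + perCoinvD n • htpyTransfer n

/-- Extension of coefficients for comparison data. -/
noncomputable def Comparison.baseChange {φ : C3 →* G} {s : G} (K : Comparison φ s ℤ)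
    (A : Type) [AddCommGroup A] [Module ℤ A] : Comparison φ s A where
  toPer n := coeffs A (K.toPer n)
  toBar n := coeffs A (K.toBar n)
  transfer n := coeffs A (K.transfer n)
  htpyBar n := coeffs A (K.htpyBar n)
  htpyInv n := coeffs A (K.htpyInv n)
  htpyConj n := coeffs A (K.htpyConj n)
  htpyTransfer n := coeffs A (K.htpyTransfer n)
  toPer_comm n := by
    simpa only [coeffs_comp, coeffs_smul, coeffs_d] using congrArg (coeffs A) (K.toPer_comm n)
  toBar_comm n := by
    simpa only [coeffs_comp, coeffs_smul, coeffs_d] using congrArg (coeffs A) (K.toBar_comm n)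
  transfer_comm n := by
    simpa only [coeffs_comp, coeffs_smul, coeffs_d] using
      congrArg (coeffs A) (K.transfer_comm n)
  toBar_toPer n := by
    simpa only [coeffs_comp, coeffs_smul, coeffs_d, coeffs_add, coeffs_sub, coeffs_id] using
      congrArg (coeffs A) (K.toBar_toPer n)
  inv_toBar n := by
    simpa only [coeffs_comp, coeffs_smul, coeffs_d, coeffs_add, coeffs_sub, coeffs_chainsMap]
      using congrArg (coeffs A) (K.inv_toBar n)
  conj_sub n := by
    simpa only [coeffs_comp, coeffs_d, coeffs_add, coeffs_sub, coeffs_id, coeffs_chainsMap]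
      using congrArg (coeffs A) (K.conj_sub n)
  transfer_toBar n := by
    simpa only [coeffs_comp, coeffs_smul, coeffs_add, coeffs_sub, coeffs_id, coeffs_chainsMap]
      using congrArg (coeffs A) (K.transfer_toBar n)

/-- Integral comparison data exist. -/
theorem exists_comparison (φ : C3 →* G) (hφ : Function.Injective φ) (s : G) (hs : s * s = 1)
    (hconj : ∀ c, s * φ c = φ c⁻¹ * s) (hcover : ∀ g, ∃ c, g = φ c ∨ g = φ c * s) :
    Nonempty (Comparison φ s ℤ) := by
  obtain ⟨a⟩ := FreeRes.exists_hom (MonoidHom.id C3) (bar C3) per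
  obtain ⟨b⟩ := FreeRes.exists_hom (MonoidHom.id C3) per (bar C3)
  obtain ⟨r⟩ := FreeRes.exists_hom (MonoidHom.id C3) (FreeRes.res φ hφ (bar G)) per
  let L : ∀ n, ((G × (Fin n → G)) →₀ ℤ) →ₗ[ℤ] ((G × (Fin n → G)) →₀ ℤ) :=
    fun n => lmapDomain ℤ ℤ (leftAct G (Fin n → G) s)
  let F : FreeRes.Hom φ per (bar G) := (barMap φ).comp b
  have hr : ∀ n c x, r.f n (lmapDomain ℤ ℤ (leftAct G (Fin n → G) (φ c)) x)
      = lmapDomain ℤ ℤ (leftAct C3 Unit c) (r.f n x) := fun n c x => r.equivariant n c x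
  have hmul : ∀ n g h (x : (G × (Fin n → G)) →₀ ℤ),
      lmapDomain ℤ ℤ (leftAct G (Fin n → G) g) (lmapDomain ℤ ℤ (leftAct G (Fin n → G) h) x)
        = lmapDomain ℤ ℤ (leftAct G (Fin n → G) (g * h)) x := by
    intro n g h x
    rw [map_mul, lmapDomain_apply, lmapDomain_apply, lmapDomain_apply, ← mapDomain_comp]
    rfl
  let rF : FreeRes.Hom (MonoidHom.id C3) per per :=
    { f := fun n => r.f n ∘ₗ F.f n
      comm := fun n x => (r.comm n _).trans (congrArg (r.f n) (F.comm n x))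
      equivariant := fun n g x => by
        simp only [LinearMap.comp_apply, F.equivariant, hr, MonoidHom.id_apply]
      aug_f := fun x => (r.aug_f _).trans (F.aug_f x) }
  let rsF : FreeRes.Hom inv3 per per :=
    { f := fun n => r.f n ∘ₗ L n ∘ₗ F.f n
      comm := fun n x => (r.comm n _).trans (congrArg (r.f n)
        ((barD_act n s _).trans (congrArg (L n) (F.comm n x))))
      equivariant := fun n g x => by
        simp only [LinearMap.comp_apply, F.equivariant, L, hmul, hconj]
        rw [← hmul, hr]
        rfl
      aug_f := fun x => (r.aug_f _).trans ((aug_lmapDomain _ _).trans (F.aug_f x)) }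
  obtain ⟨h₁, he₁, hh₁⟩ := FreeRes.exists_homotopy (b.comp a) (FreeRes.Hom.id (bar C3))
  obtain ⟨h₂, he₂, hh₂⟩ := FreeRes.exists_homotopy (ψ := inv3) ((barMap inv3).comp b)
    (b.comp perInv)
  obtain ⟨h₃, he₃, hh₃⟩ := FreeRes.exists_homotopy (barMap (MulAut.conj s).toMonoidHom)
    (barTranslate s)
  obtain ⟨h₄, he₄, hh₄⟩ := FreeRes.exists_homotopy rF (FreeRes.Hom.id per)
  obtain ⟨h₅, he₅, hh₅⟩ := FreeRes.exists_homotopy rsF perInv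
  let U : ∀ n, ((G × (Fin n → G)) →₀ ℤ) →ₗ[ℤ] (Unit →₀ ℤ) :=
    fun n => proj C3 Unit ∘ₗ r.f n ∘ₗ (LinearMap.id + L n)
  have hU_apply : ∀ n x, U n x = proj C3 Unit (r.f n x) + proj C3 Unit (r.f n (L n x)) := by
    intro n x
    simp [U]
  have hUφ : ∀ n c x, U n (lmapDomain ℤ ℤ (leftAct G (Fin n → G) (φ c)) x) = U n x := by
    intro n c x
    simp only [hU_apply, L, hmul, hconj]
    rw [← hmul, hr, hr, proj_leftAct, proj_leftAct]
  have hUs : ∀ n x, U n (lmapDomain ℤ ℤ (leftAct G (Fin n → G) s) x) = U n x := by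
    intro n x
    simp only [hU_apply, L, hmul, hs]
    rw [map_one, add_comm]
    simp
  have hU : ∀ n g x, U n (lmapDomain ℤ ℤ (leftAct G (Fin n → G) g) x) = U n x := by
    intro n g x
    obtain ⟨c, rfl | rfl⟩ := hcover g
    · exact hUφ n c x
    · rw [← hmul, hUφ, hUs]
  have hUsec : ∀ n x, U n (sec G _ (proj G _ x)) = U n x :=
    fun n => apply_sec_proj (U n) (hU n)
  have hUd : ∀ n x, desc (perD n) (U (n + 1) x) = U n (barD G n x) := by
    intro n x
    rw [hU_apply, hU_apply, map_add, desc_proj (MonoidHom.id C3) _ (per.d_act n),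
      desc_proj (MonoidHom.id C3) _ (per.d_act n)]
    exact congrArg₂ (fun y z => proj C3 Unit y + proj C3 Unit z) (r.comm n x)
      ((r.comm n _).trans (congrArg (r.f n) (barD_act n s x)))
  have hperD : ∀ n (M : Type) [AddCommGroup M] (f : M →ₗ[ℤ] (Unit →₀ ℤ)),
      perCoinvD n • f = desc (perD n) ∘ₗ f := by
    intro n M _ f
    rw [desc_perD, LinearMap.smul_comp, LinearMap.id_comp]
  have hperD' : ∀ n (M : Type) [AddCommGroup M] (f : (Unit →₀ ℤ) →ₗ[ℤ] M),
      perCoinvD n • f = f ∘ₗ desc (perD n) := by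
    intro n M _ f
    rw [desc_perD, LinearMap.comp_smul, LinearMap.comp_id]
  refine ⟨{
    toPer := fun n => desc (a.f n)
    toBar := fun n => desc (b.f n)
    transfer := fun n => U n ∘ₗ sec G _
    htpyBar := fun n => desc (h₁ n)
    htpyInv := fun n => desc (h₂ n)
    htpyConj := fun n => desc (h₃ n)
    htpyTransfer := fun n => desc (h₄ n) + desc (h₅ n)
    toPer_comm := fun n => ?_
    toBar_comm := fun n => ?_
    transfer_comm := fun n => ?_
    toBar_toPer := fun n => ?_
    inv_toBar := fun n => ?_
    conj_sub := fun n => ?_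
    transfer_toBar := fun n => ?_ }⟩
  · rw [hperD, ← desc_barD, ← desc_comp (MonoidHom.id C3) _ (per.d_act n),
      ← desc_comp (MonoidHom.id C3) _ (a.equivariant n)]
    exact congrArg desc (LinearMap.ext (a.comm n))
  · rw [hperD', ← desc_barD, ← desc_comp (MonoidHom.id C3) _ ((bar C3).d_act n),
      ← desc_comp (MonoidHom.id C3) _ (b.equivariant n)]
    exact congrArg desc (LinearMap.ext (b.comm n))
  · rw [hperD, ← desc_barD]
    ext1 x
    ext1
    exact (hUd n _).trans (hUsec n _).symm
  · have := desc_homotopy (MonoidHom.id C3) ((bar C3).d_act (n + 1)) (he₁ n) (hh₁ n)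
    rw [← desc_barD, ← desc_barD, ← desc_comp (MonoidHom.id C3) _ (b.equivariant (n + 1))]
    exact (congrArg₂ (· - ·) rfl desc_id.symm).trans this
  · have := desc_homotopy inv3 ((bar C3).d_act (n + 1)) (he₂ n) (hh₂ n)
    rw [hperD', ← desc_barD, ← desc_barMap,
      ← desc_comp inv3 _ ((barMap inv3).equivariant (n + 1))]
    refine Eq.trans (congrArg₂ (· - ·) rfl ?_) this
    refine Eq.trans ?_ (desc_comp (MonoidHom.id C3) _ (b.equivariant (n + 1)) _).symm
    rw [desc_perInv, LinearMap.comp_smul, LinearMap.comp_id]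
  · have := desc_homotopy _ ((bar G).d_act (n + 1)) (he₃ n) (hh₃ n)
    rw [← desc_barD, ← desc_barD, ← desc_barMap, ← desc_barTranslate s]
    exact this
  · have e₄ := desc_homotopy _ (per.d_act (n + 1)) (he₄ n) (hh₄ n)
    have e₅ := desc_homotopy _ (per.d_act (n + 1)) (he₅ n) (hh₅ n)
    have e : (U (n + 1) ∘ₗ sec G _) ∘ₗ chainsMap ℤ ℤ φ (n + 1) ∘ₗ desc (b.f (n + 1))
        = desc (rF.f (n + 1)) + desc (rsF.f (n + 1)) := by
      rw [← desc_barMap, ← desc_comp φ _ ((barMap φ).equivariant (n + 1))]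
      ext1 x
      ext1
      exact (hUsec (n + 1) _).trans (hU_apply (n + 1) _)
    have e₄' : desc ((FreeRes.Hom.id per).f (n + 1)) = LinearMap.id := desc_id
    rw [e₄'] at e₄
    rw [desc_perInv] at e₅
    rw [e, hperD, hperD', LinearMap.comp_add, LinearMap.add_comp, add_smul, one_smul,
      add_sub_add_comm, e₄, e₅]
    exact add_add_add_comm _ _ _ _

end Comparison

section Homology

variable {k : Type} [CommRing k] {G G' : Type} [Group G] [Group G'] {A : Type} [AddCommGroup A]
  [Module k A] {ψ : G →* G'} {n : ℕ}

lemma mk_eq_zero_iff (z : cycles k G A n) :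
    (Submodule.Quotient.mk z : GroupHomology k G A n) = 0 ↔ ∃ w, d k G A n w = z :=
  Submodule.Quotient.mk_eq_zero _

lemma injective_inducedMap (h : ∀ z ∈ cycles k G A n, ∀ v,
    d k G' A n v = chainsMap k A ψ n z → ∃ w, d k G A n w = z) :
    Function.Injective (inducedMap k A ψ n) := by
  rw [injective_iff_map_eq_zero]
  intro x hx
  induction x using Submodule.Quotient.induction_on with
  | _ z =>
    obtain ⟨v, hv⟩ := (mk_eq_zero_iff _).mp hx
    exact (mk_eq_zero_iff z).mpr (h z z.2 v hv)

lemma inducedMap_eq_zero (h : ∀ z ∈ cycles k G A n, ∃ v,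
    d k G' A n v = chainsMap k A ψ n z) : inducedMap k A ψ n = 0 := by
  refine LinearMap.ext fun x => ?_
  induction x using Submodule.Quotient.induction_on with
  | _ z => exact (mk_eq_zero_iff (cyclesMap k A ψ n z)).mpr (h z z.2)

end Homology

section Induced

variable {G : Type} [Group G] {A : Type} [AddCommGroup A] [Module ℤ A]

lemma exists_three_smul_eq {M : Type} [AddCommGroup M] {n : ℕ} {p : M}
    (hp : perCoinvD n • p = 0) : ∃ t, (3 : ℤ) • p = perCoinvD (n + 1) • t := by
  by_cases h : Even n
  · exact ⟨p, by rw [perCoinvD, if_neg (by simpa [Nat.even_add_one] using h)]⟩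
  · refine ⟨0, ?_⟩
    rw [perCoinvD, if_neg h] at hp
    rw [hp, smul_zero]

lemma sgn_eq_one {n : ℕ} (h : n % 4 = 3 ∨ n % 4 = 0) : sgn n = 1 :=
  Even.neg_one_pow ⟨(n + 1) / 4, by lia⟩

lemma sgn_eq_neg_one {n : ℕ} (h : ¬ (n % 4 = 3 ∨ n % 4 = 0)) : sgn n = -1 :=
  Odd.neg_one_pow ⟨(n + 1) / 4, by lia⟩

lemma zsmul_linearMap_apply {M N : Type} [AddCommGroup M] [AddCommGroup N] [Module ℤ M]
    [Module ℤ N] (m : ℤ) (f : M →ₗ[ℤ] N) (x : M) : (m • f) x = m • f x :=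
  map_zsmul (LinearMap.evalAddMonoidHom x) m f

namespace Comparison

variable {φ : C3 →* G} {s : G}

lemma exists_toBar_eq (K : Comparison φ s A) {n : ℕ} {z : chains C3 A (n + 1)} (hz : d ℤ C3 A n z = 0) :
    ∃ p w, perCoinvD n • p = 0 ∧ z = K.toBar (n + 1) p + d ℤ C3 A (n + 1) w := by
  have h₁ := LinearMap.congr_fun (K.toPer_comm n) z
  have h₂ := LinearMap.congr_fun (K.toBar_toPer n) z
  simp only [zsmul_linearMap_apply, LinearMap.comp_apply, hz, map_zero, LinearMap.sub_apply,
    LinearMap.add_apply, LinearMap.id_apply, add_zero] at h₁ h₂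
  refine ⟨K.toPer (n + 1) z, -K.htpyBar (n + 1) z, h₁, ?_⟩
  rw [map_neg, ← h₂]
  abel

lemma exists_d_eq_toBar (K : Comparison φ s A) {n : ℕ} {p : Unit →₀ A} {y : Unit →₀ A}
    (hp : p = perCoinvD n • y) : ∃ w, d ℤ C3 A n w = K.toBar n p := by
  refine ⟨K.toBar (n + 1) y, ?_⟩
  have h := LinearMap.congr_fun (K.toBar_comm n) y
  rw [zsmul_linearMap_apply, LinearMap.comp_apply] at h
  rw [h, hp, map_zsmul]

lemma d_toBar (K : Comparison φ s A) {n : ℕ} {p : Unit →₀ A} (hp : perCoinvD n • p = 0) :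
    d ℤ C3 A n (K.toBar (n + 1) p) = 0 := by
  have h := LinearMap.congr_fun (K.toBar_comm n) p
  rw [zsmul_linearMap_apply, LinearMap.comp_apply, ← map_zsmul, hp, map_zero] at h
  exact h

/-- Where inversion acts by `1`, only boundaries become boundaries in the overgroup. -/
lemma exists_d_eq_of_chainsMap (K : Comparison φ s A) {n : ℕ} (hn : sgn (n + 1) = 1) {z : chains C3 A (n + 1)}
    (hz : d ℤ C3 A n z = 0) {v : chains G A (n + 2)}
    (hv : d ℤ G A (n + 1) v = chainsMap ℤ A φ (n + 1) z) : ∃ w, d ℤ C3 A (n + 1) w = z := by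
  obtain ⟨p, w, hp, rfl⟩ := K.exists_toBar_eq hz
  obtain ⟨t, ht⟩ := exists_three_smul_eq hp
  have comm := LinearMap.congr_fun (chainsMap_comm (k := ℤ) (A := A) φ (n + 1)) w
  have hT := LinearMap.congr_fun (K.transfer_toBar n) p
  have hc := LinearMap.congr_fun (K.transfer_comm (n + 1)) (v - chainsMap ℤ A φ (n + 2) w)
  simp only [zsmul_linearMap_apply, LinearMap.comp_apply, LinearMap.sub_apply,
    LinearMap.add_apply, LinearMap.id_apply, hn, one_add_one_eq_two, ← map_zsmul (K.htpyTransfer n), hp, map_zero,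
    add_zero] at hT hc comm
  rw [map_sub (d ℤ G A (n + 1)), hv, comm, map_add (chainsMap ℤ A φ (n + 1)),
    add_sub_cancel_right] at hc
  have hp' : p = perCoinvD (n + 1) • (t - K.transfer (n + 2) (v - chainsMap ℤ A φ (n + 2) w)
      + K.htpyTransfer (n + 1) p) := by
    rw [zsmul_add, zsmul_sub, ← ht, hc, ← hT]
    abel
  obtain ⟨u, hu⟩ := K.exists_d_eq_toBar hp'
  exact ⟨u + w, by rw [map_add, hu]⟩

/-- Where inversion acts by `-1`, all cycles become boundaries in the overgroup. -/
lemma exists_d_eq_chainsMap (K : Comparison φ s A) (hconj : ∀ c, s * φ c = φ c⁻¹ * s)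
    {n : ℕ} (hn : sgn (n + 1) = -1) {z : chains C3 A (n + 1)} (hz : d ℤ C3 A n z = 0) :
    ∃ v, d ℤ G A (n + 1) v = chainsMap ℤ A φ (n + 1) z := by
  obtain ⟨p, w, hp, rfl⟩ := K.exists_toBar_eq hz
  obtain ⟨t, ht⟩ := exists_three_smul_eq hp
  obtain ⟨u, hu⟩ := K.exists_d_eq_toBar ht
  have comm := fun x => LinearMap.congr_fun (chainsMap_comm (k := ℤ) (A := A) φ (n + 1)) x
  have hcyc : d ℤ G A n (chainsMap ℤ A φ (n + 1) (K.toBar (n + 1) p)) = 0 := by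
    have h := LinearMap.congr_fun (chainsMap_comm (k := ℤ) (A := A) φ n) (K.toBar (n + 1) p)
    simpa only [LinearMap.comp_apply, K.d_toBar hp, map_zero] using h
  have hsq : chainsMap ℤ A (MulAut.conj s).toMonoidHom (n + 1) ∘ₗ chainsMap ℤ A φ (n + 1)
      = chainsMap ℤ A φ (n + 1) ∘ₗ chainsMap ℤ A inv3 (n + 1) := by
    apply Finsupp.lhom_ext
    intro g a
    simp only [chainsMap, LinearMap.comp_apply, lmapDomain_apply, mapDomain_single]
    congr 1
    funext i
    exact mul_inv_eq_of_eq_mul (hconj (g i))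
  have hI := congrArg (chainsMap ℤ A φ (n + 1)) (LinearMap.congr_fun (K.inv_toBar n) p)
  have hC := LinearMap.congr_fun (K.conj_sub n)
    (chainsMap ℤ A φ (n + 1) (K.toBar (n + 1) p))
  have hs := LinearMap.congr_fun hsq (K.toBar (n + 1) p)
  simp only [zsmul_linearMap_apply, LinearMap.comp_apply, LinearMap.sub_apply,
    LinearMap.add_apply, LinearMap.id_apply, hn, hcyc,
    ← map_zsmul (K.htpyInv n), hp, map_zero, add_zero] at hI hC hs comm
  rw [map_sub, map_zsmul, ← hs, ← comm] at hI
  refine ⟨chainsMap ℤ A φ (n + 2) (u + w - K.htpyInv (n + 1) p)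
    + K.htpyConj (n + 1) (chainsMap ℤ A φ (n + 1) (K.toBar (n + 1) p)), ?_⟩
  rw [map_add, map_sub, map_sub, map_add, map_add, map_add, ← hC, ← hI, comm, comm, hu,
    map_zsmul, map_zsmul]
  abel

end Comparison

/-- The map induced by the inclusion of `C3` in a group in which an involution `s` inverts `C3`
and `C3` has index two. -/
theorem induced_C3 (φ : C3 →* G) (hφ : Function.Injective φ) (s : G) (hs : s * s = 1)
    (hconj : ∀ c, s * φ c = φ c⁻¹ * s) (hcover : ∀ g, ∃ c, g = φ c ∨ g = φ c * s)
    (A : Type) [AddCommGroup A] [Module ℤ A] {q : ℕ} (hq : 1 ≤ q) :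
    ((q % 4 = 3 ∨ q % 4 = 0) → Function.Injective (inducedMap ℤ A φ q)) ∧
      (¬ (q % 4 = 3 ∨ q % 4 = 0) → inducedMap ℤ A φ q = 0) := by
  obtain ⟨n, rfl⟩ : ∃ n, q = n + 1 := ⟨q - 1, by lia⟩
  obtain ⟨K₀⟩ := exists_comparison φ hφ s hs hconj hcover
  let K := K₀.baseChange A
  constructor
  · exact fun h => injective_inducedMap fun z hz v hv =>
      K.exists_d_eq_of_chainsMap (sgn_eq_one h) hz hv
  · exact fun h => inducedMap_eq_zero fun z hz =>
      K.exists_d_eq_chainsMap hconj (sgn_eq_neg_one h) hz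

end Induced

section SymmetricGroup

lemma swap_mul_of_pow_three (p : Equiv.Perm (Fin 3)) (hp : p * p * p = 1) :
    Equiv.swap 0 1 * p = p⁻¹ * Equiv.swap 0 1 := by
  revert p
  decide

lemma perm_cases (p : Equiv.Perm (Fin 3)) (hp : p * p * p = 1) (hp₁ : p ≠ 1)
    (g : Equiv.Perm (Fin 3)) :
    (g = 1 ∨ g = p ∨ g = p * p) ∨
      (g = Equiv.swap 0 1 ∨ g = p * Equiv.swap 0 1 ∨ g = p * p * Equiv.swap 0 1) := by
  revert p g
  decide

variable (φ : C3 →* Equiv.Perm (Fin 3))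

lemma map_pow_three (c : C3) : φ c * φ c * φ c = 1 := by
  have h : c * c * c = 1 := by
    revert c
    decide
  rw [← map_mul, ← map_mul, h, map_one]

lemma swap_mul_map (c : C3) : Equiv.swap 0 1 * φ c = φ c⁻¹ * Equiv.swap 0 1 := by
  rw [map_inv, swap_mul_of_pow_three _ (map_pow_three φ c)]

lemma exists_eq_map_or (hφ : Function.Injective φ) (g : Equiv.Perm (Fin 3)) :
    ∃ c, g = φ c ∨ g = φ c * Equiv.swap 0 1 := by
  have h₁ : φ gen ≠ 1 := fun h => absurd (hφ (h.trans (map_one φ).symm)) (by decide)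
  rcases perm_cases (φ gen) (map_pow_three φ gen) h₁ g with
    (h | h | h) | h | h | h
  · exact ⟨1, Or.inl (by rw [h, map_one])⟩
  · exact ⟨gen, Or.inl h⟩
  · exact ⟨gen * gen, Or.inl (by rw [h, map_mul])⟩
  · exact ⟨1, Or.inr (by rw [h, map_one, one_mul])⟩
  · exact ⟨gen, Or.inr h⟩
  · exact ⟨gen * gen, Or.inr (by rw [h, map_mul])⟩

end SymmetricGroup

end BarHomology

open BarHomology

/-- An inclusion `ℤ/3 → S₃` induces an injection on group homology (with trivial
coefficients `ℤ`, `ℤ/2`, `ℤ/3`, `ℤ/4`) in degrees `≡ 3, 0 (mod 4)`, and the zero map in all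
other positive degrees. -/
theorem induced_Z3_to_S3 (φ : Multiplicative (ZMod 3) →* Equiv.Perm (Fin 3))
    (hφ : Function.Injective φ) (q : ℕ) (hq : 1 ≤ q) :
    ((q % 4 = 3 ∨ q % 4 = 0) →
      Function.Injective (inducedMap ℤ ℤ φ q) ∧
      Function.Injective (inducedMap ℤ (ZMod 2) φ q) ∧
      Function.Injective (inducedMap ℤ (ZMod 3) φ q) ∧
      Function.Injective (inducedMap ℤ (ZMod 4) φ q)) ∧
    (¬(q % 4 = 3 ∨ q % 4 = 0) →
      inducedMap ℤ ℤ φ q = 0 ∧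
      inducedMap ℤ (ZMod 2) φ q = 0 ∧
      inducedMap ℤ (ZMod 3) φ q = 0 ∧
      inducedMap ℤ (ZMod 4) φ q = 0) := by
  have H := fun (A : Type) [AddCommGroup A] [Module ℤ A] => induced_C3 φ hφ (Equiv.swap 0 1)
    (Equiv.swap_mul_self 0 1) (swap_mul_map φ) (exists_eq_map_or φ hφ) A hq
  exact ⟨fun h => ⟨(H ℤ).1 h, (H (ZMod 2)).1 h, (H (ZMod 3)).1 h, (H (ZMod 4)).1 h⟩,
    fun h => ⟨(H ℤ).2 h, (H (ZMod 2)).2 h, (H (ZMod 3)).2 h, (H (ZMod 4)).2 h⟩⟩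
end
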